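/- arXiv:1402.2221 — 8 statements merged into one kernel-verified Lean document; each statement's English description precedes it below -/
import Mathlib

section
/- One has ℝ^d_+ \ {0} ⊆ int K_d and K_d^+ \ {0} ⊆ int ℝ^d_+; that is, every nonzero vector with nonnegative components lies in the interior of the solvency cone, and every nonzero vector of the dual cone has all components strictly positive. -/
noncomputable section

/-- The solvency cone induced by the matrix `π`: the set of all nonnegative linear
combinations of the vectors `π i j • e^i - e^j`. -/
def solvencyCone (d : ℕ) (π : Fin d → Fin d → ℝ) : Set (Fin d → ℝ) :=
  {x | ∃ z : Fin d → Fin d → ℝ, (∀ i j, 0 ≤ z i j) ∧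
    x = ∑ i : Fin d, ∑ j : Fin d, z i j • (π i j • (Pi.single i 1 : Fin d → ℝ) - (Pi.single j 1 : Fin d → ℝ))}

/-- The (positive) dual cone of a set `K ⊆ ℝ^d`. -/
def dualCone (d : ℕ) (K : Set (Fin d → ℝ)) : Set (Fin d → ℝ) :=
  {y | ∀ x ∈ K, 0 ≤ ∑ l : Fin d, x l * y l}

section SolvencyCone

variable {d : ℕ} {π : Fin d → Fin d → ℝ}

theorem zero_mem_solvencyCone : (0 : Fin d → ℝ) ∈ solvencyCone d π :=
  ⟨0, fun _ _ => le_rfl, by simp⟩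

theorem add_mem_solvencyCone {x y : Fin d → ℝ} (hx : x ∈ solvencyCone d π)
    (hy : y ∈ solvencyCone d π) : x + y ∈ solvencyCone d π := by
  obtain ⟨z, hz, rfl⟩ := hx
  obtain ⟨w, hw, rfl⟩ := hy
  exact ⟨z + w, fun i j => add_nonneg (hz i j) (hw i j), by
    simp only [Pi.add_apply, add_smul, Finset.sum_add_distrib]⟩

theorem smul_mem_solvencyCone {x : Fin d → ℝ} {c : ℝ} (hc : 0 ≤ c)
    (hx : x ∈ solvencyCone d π) : c • x ∈ solvencyCone d π := by
  obtain ⟨z, hz, rfl⟩ := hx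
  exact ⟨c • z, fun i j => mul_nonneg hc (hz i j), by
    simp only [Pi.smul_apply, smul_assoc, Finset.smul_sum]⟩

theorem sum_mem_solvencyCone {ι : Type*} {s : Finset ι} {f : ι → Fin d → ℝ}
    (hf : ∀ a ∈ s, f a ∈ solvencyCone d π) : ∑ a ∈ s, f a ∈ solvencyCone d π :=
  Finset.sum_induction f (· ∈ solvencyCone d π) (fun _ _ => add_mem_solvencyCone)
    zero_mem_solvencyCone hf

theorem generator_mem_solvencyCone (i j : Fin d) :
    π i j • (Pi.single i 1 : Fin d → ℝ) - (Pi.single j 1 : Fin d → ℝ) ∈ solvencyCone d π := by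
  refine ⟨fun a b => if a = i then if b = j then 1 else 0 else 0, fun a b => ?_, ?_⟩
  · dsimp only
    split_ifs <;> norm_num
  · rw [Finset.sum_eq_single i, Finset.sum_eq_single j] <;> simp +contextual

/-- A triangle with strict inequality yields a pair of assets with a strictly positive
round-trip cost. -/
theorem exists_one_lt_mul_of_lt_mul (h2 : ∀ i j, 0 < π i j)
    (h3 : ∀ i j k, π i j ≤ π i k * π k j) {i j k : Fin d}
    (h : π i j < π i k * π k j) : 1 < π k j * π j k := by
  have hik := h3 i k j
  have h' : π i k < π i k * (π k j * π j k) := by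
    nlinarith [mul_lt_mul_of_pos_right h (h2 j k)]
  exact (lt_mul_iff_one_lt_right (h2 i k)).1 h'

theorem single_mem_solvencyCone (h2 : ∀ i j, 0 < π i j) {a b : Fin d}
    (hab : 1 < π a b * π b a) (l : Fin d) :
    (Pi.single l 1 : Fin d → ℝ) ∈ solvencyCone d π := by
  have ha : (Pi.single a 1 : Fin d → ℝ) ∈ solvencyCone d π := by
    have h := smul_mem_solvencyCone (inv_nonneg.2 (sub_pos.2 hab).le)
      (add_mem_solvencyCone (generator_mem_solvencyCone (π := π) b a)
        (smul_mem_solvencyCone (h2 b a).le (generator_mem_solvencyCone a b)))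
    convert h using 1
    rw [eq_inv_smul_iff₀ (sub_pos.2 hab).ne']
    module
  have h := smul_mem_solvencyCone (inv_nonneg.2 (h2 l a).le)
    (add_mem_solvencyCone (generator_mem_solvencyCone l a) ha)
  rwa [sub_add_cancel, inv_smul_smul₀ (h2 l a).ne'] at h

/-- A position whose holding in asset `i` covers all its short positions is solvent. -/
theorem mem_solvencyCone_of_sum_le
    (hsingle : ∀ l, (Pi.single l 1 : Fin d → ℝ) ∈ solvencyCone d π) {i : Fin d}
    {y : Fin d → ℝ} (hy : ∑ j, π i j * max (-y j) 0 ≤ y i) : y ∈ solvencyCone d π := by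
  have hpos (l : Fin d) : 0 ≤ y l + max (-y l) 0 := by
    linarith [le_max_left (-y l) 0]
  have hmem : ∑ j, max (-y j) 0 •
        (π i j • (Pi.single i 1 : Fin d → ℝ) - (Pi.single j 1 : Fin d → ℝ)) +
      ∑ l, (y l + max (-y l) 0 - if l = i then ∑ j, π i j * max (-y j) 0 else 0) •
        (Pi.single l 1 : Fin d → ℝ) ∈ solvencyCone d π := by
    refine add_mem_solvencyCone
      (sum_mem_solvencyCone fun j _ =>
        smul_mem_solvencyCone (le_max_right _ _) (generator_mem_solvencyCone i j))
      (sum_mem_solvencyCone fun l _ => smul_mem_solvencyCone ?_ (hsingle l))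
    split_ifs with h
    · subst h
      linarith [le_max_right (-y l) 0]
    · linarith [hpos l]
  convert hmem using 1
  ext m
  by_cases hm : m = i
  · subst hm
    simp [Finset.sum_apply, Pi.single_apply, mul_sub, Finset.sum_sub_distrib, mul_comm]
  · simp [Finset.sum_apply, Pi.single_apply, hm]

theorem mem_interior_solvencyCone
    (hsingle : ∀ l, (Pi.single l 1 : Fin d → ℝ) ∈ solvencyCone d π) {x : Fin d → ℝ}
    (hx : ∀ i, 0 ≤ x i) (hx0 : x ≠ 0) : x ∈ interior (solvencyCone d π) := by
  obtain ⟨i, hi⟩ := Function.ne_iff.1 hx0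
  refine mem_interior.2 ⟨{y | ∑ j, π i j * max (-y j) 0 < y i},
    fun y hy => mem_solvencyCone_of_sum_le hsingle (le_of_lt hy),
    isOpen_lt (by fun_prop) (by fun_prop), ?_⟩
  simpa [hx] using lt_of_le_of_ne (hx i) (Ne.symm hi)

theorem le_mul_of_mem_dualCone {y : Fin d → ℝ} (hy : y ∈ dualCone d (solvencyCone d π))
    (i j : Fin d) : y j ≤ π i j * y i := by
  have h := hy _ (generator_mem_solvencyCone i j)
  simpa [Pi.single_apply, sub_mul, Finset.sum_sub_distrib] using h

theorem pos_of_mem_dualCone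
    (hsingle : ∀ l, (Pi.single l 1 : Fin d → ℝ) ∈ solvencyCone d π) {y : Fin d → ℝ}
    (hy : y ∈ dualCone d (solvencyCone d π)) (hy0 : y ≠ 0) (i : Fin d) : 0 < y i := by
  have hnonneg (l : Fin d) : 0 ≤ y l := by
    simpa [Pi.single_apply] using hy _ (hsingle l)
  refine lt_of_le_of_ne (hnonneg i) fun hi => hy0 (funext fun j => ?_)
  have h := le_mul_of_mem_dualCone hy i j
  rw [← hi, mul_zero] at h
  exact le_antisymm h (hnonneg j)

end SolvencyCone

/-- Proposition 2: `ℝ^d_+ \ {0} ⊆ int K_d` and `K_d^+ \ {0} ⊆ int ℝ^d_+`. -/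
theorem orthant_subset_interior_solvencyCone (d : ℕ) (hd : 2 ≤ d) (π : Fin d → Fin d → ℝ)
    (h1 : ∀ i, π i i = 1)
    (h2 : ∀ i j, 0 < π i j)
    (h3 : ∀ i j k, π i j ≤ π i k * π k j)
    (h4 : ∃ i j k, π i j < π i k * π k j) :
    ({x : Fin d → ℝ | ∀ i, 0 ≤ x i} \ {0} ⊆ interior (solvencyCone d π)) ∧
    (dualCone d (solvencyCone d π) \ {0} ⊆ interior {x : Fin d → ℝ | ∀ i, 0 ≤ x i}) := by
  obtain ⟨i, j, k, h⟩ := h4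
  have hsingle := single_mem_solvencyCone h2 (exists_one_lt_mul_of_lt_mul h2 h3 h)
  refine ⟨fun x hx => mem_interior_solvencyCone hsingle hx.1 hx.2, fun y hy => ?_⟩
  refine mem_interior.2 ⟨{x | ∀ i, 0 < x i}, fun x hx i => (hx i).le, ?_,
    pos_of_mem_dualCone hsingle hy.1 hy.2⟩
  simp only [Set.ofPred_forall]
  exact isOpen_iInter_of_finite fun i => isOpen_lt continuous_const (continuous_apply i)
end
end

section
/- One has K_d ∩ (−ℝ^d_+) = {0}; that is, the only vector in the solvency cone all of whose components are nonpositive is the zero vector. -/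
noncomputable section

/-- Each row of a matrix satisfying the multiplicative triangle inequality lies in the dual
of the solvency cone. -/
theorem row_mem_dualCone_solvencyCone (d : ℕ) (π : Fin d → Fin d → ℝ)
    (h : ∀ i j k, π i j ≤ π i k * π k j) (k : Fin d) :
    π k ∈ dualCone d (solvencyCone d π) := by
  rintro x ⟨z, hz, rfl⟩
  have key : ∑ l, (∑ i, ∑ j, z i j • (π i j • (Pi.single i 1 : Fin d → ℝ) -
      (Pi.single j 1 : Fin d → ℝ))) l * π k l =
      ∑ i, ∑ j, z i j * (π i j * π k i - π k j) := by
    change (∑ i, ∑ j, z i j • (π i j • (Pi.single i 1 : Fin d → ℝ) -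
      (Pi.single j 1 : Fin d → ℝ))) ⬝ᵥ π k = _
    simp [sum_dotProduct, sub_dotProduct, smul_dotProduct]
  rw [key]
  refine Finset.sum_nonneg fun i _ => Finset.sum_nonneg fun j _ => mul_nonneg (hz i j) ?_
  linarith [h k j i, mul_comm (π k i) (π i j)]

/-- Proposition 3: `K_d ∩ (−ℝ^d_+) = {0}`. -/
theorem solvencyCone_inter_neg_orthant (d : ℕ) (hd : 2 ≤ d) (π : Fin d → Fin d → ℝ)
    (h1 : ∀ i, π i i = 1)
    (h2 : ∀ i j, 0 < π i j)
    (h3 : ∀ i j k, π i j ≤ π i k * π k j)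
    (h4 : ∃ i j k, π i j < π i k * π k j) :
    solvencyCone d π ∩ {x : Fin d → ℝ | ∀ i, x i ≤ 0} = {0} := by
  ext x
  rw [Set.mem_singleton_iff]
  constructor
  · rintro ⟨hx, hneg⟩
    have k : Fin d := ⟨0, by omega⟩
    have hterm : ∀ l ∈ Finset.univ, x l * π k l ≤ 0 := fun l _ =>
      mul_nonpos_of_nonpos_of_nonneg (hneg l) (h2 k l).le
    have hsum : ∑ l, x l * π k l = 0 :=
      le_antisymm (Finset.sum_nonpos hterm) (row_mem_dualCone_solvencyCone d π h3 k x hx)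
    funext l
    have hl := (Finset.sum_eq_zero_iff_of_nonpos hterm).1 hsum l (Finset.mem_univ l)
    exact (mul_eq_zero.1 hl).resolve_right (h2 k l).ne'
  · rintro rfl
    exact ⟨⟨0, by simp, by simp⟩, fun _ => le_rfl⟩
end
end

section
/- For y ∈ ℝ^d, the following are equivalent: (i) y is an extreme direction of the dual cone K_d^+; (ii) y is a feasible tree solution with respect to some bipartition (P,N) of V. -/
noncomputable section

/-- `(P, N)` is a bipartition of the vertex set `{1,…,d}`: both parts are nonempty,
disjoint, and their union is everything. -/
def IsBipartition (d : ℕ) (P N : Finset (Fin d)) : Prop :=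
  P.Nonempty ∧ N.Nonempty ∧ Disjoint P N ∧ P ∪ N = Finset.univ

/-- `T` is a spanning tree of the bipartite digraph with arc set `E`:
its arcs lie in `E` and the underlying undirected graph on all of `Fin d`
is connected and acyclic. -/
def IsSpanningTreeOf (d : ℕ) (E T : Set (Fin d × Fin d)) : Prop :=
  T ⊆ E ∧ (SimpleGraph.fromRel (fun u v => (u, v) ∈ T)).IsTree

/-- `T` is a spanning tree of the bipartite digraph `G(P,N)` with arc set `P × N`. -/
def IsSpanningTree (d : ℕ) (P N : Finset (Fin d)) (T : Set (Fin d × Fin d)) : Prop :=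
  IsSpanningTreeOf d {a | a.1 ∈ P ∧ a.2 ∈ N} T

/-- The vector `y` is generated by the tree with arc set `T`:
`π i j * y i = y j > 0` along all arcs of `T`. -/
def GeneratedByTree (d : ℕ) (π : Fin d → Fin d → ℝ) (T : Set (Fin d × Fin d))
    (y : Fin d → ℝ) : Prop :=
  ∀ a ∈ T, π a.1 a.2 * y a.1 = y a.2 ∧ 0 < y a.2

/-- The vector `y` is feasible with respect to the bipartition `(P, N)`:
`π i j * y i ≥ y j > 0` for all `(i,j) ∈ P × N`. -/
def Feasible (d : ℕ) (π : Fin d → Fin d → ℝ) (P N : Finset (Fin d))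
    (y : Fin d → ℝ) : Prop :=
  ∀ i ∈ P, ∀ j ∈ N, y j ≤ π i j * y i ∧ 0 < y j

/-- `y` is a feasible tree solution with respect to `(P, N)`. -/
def IsFeasibleTreeSolution (d : ℕ) (π : Fin d → Fin d → ℝ) (P N : Finset (Fin d))
    (y : Fin d → ℝ) : Prop :=
  ∃ T : Set (Fin d × Fin d), IsSpanningTree d P N T ∧ GeneratedByTree d π T y ∧
    Feasible d π P N y

/-- `y` is an extreme direction of the cone `K`: it is a nonzero element of `K`
which cannot be written as the sum of two directions of `K` that are not positive
multiples of `y`. -/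
def IsExtremeDir (d : ℕ) (K : Set (Fin d → ℝ)) (y : Fin d → ℝ) : Prop :=
  y ∈ K ∧ y ≠ 0 ∧ ∀ u v : Fin d → ℝ, u ∈ K → v ∈ K → u ≠ 0 → v ≠ 0 → y = u + v →
    (∃ α : ℝ, 0 < α ∧ u = α • y) ∨ (∃ α : ℝ, 0 < α ∧ v = α • y)

/-- The degree of node `i` in the arc set `T`: the number of arcs incident to `i`. -/
def treeDeg (d : ℕ) (T : Set (Fin d × Fin d)) (i : Fin d) : ℕ :=
  {a ∈ T | a.1 = i ∨ a.2 = i}.ncard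

open Filter Topology

theorem mem_dualCone_solvencyCone {d : ℕ} {π : Fin d → Fin d → ℝ} {y : Fin d → ℝ} :
    y ∈ dualCone d (solvencyCone d π) ↔ ∀ i j, y j ≤ π i j * y i := by
  have key : ∀ z : Fin d → Fin d → ℝ,
      ∑ l, (∑ i, ∑ j, z i j • (π i j • (Pi.single i 1 : Fin d → ℝ) -
        (Pi.single j 1 : Fin d → ℝ))) l * y l = ∑ i, ∑ j, z i j * (π i j * y i - y j) := by
    intro z
    change (∑ i, ∑ j, z i j • (π i j • (Pi.single i 1 : Fin d → ℝ) -
        (Pi.single j 1 : Fin d → ℝ))) ⬝ᵥ y = _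
    simp only [sum_dotProduct, smul_dotProduct, sub_dotProduct, single_dotProduct, one_mul,
      smul_eq_mul]
  constructor
  · intro hy i j
    have h := hy _ ⟨fun a b => if a = i ∧ b = j then 1 else 0,
      fun a b => by positivity, rfl⟩
    rw [key] at h
    simpa [ite_and] using h
  · rintro hy x ⟨z, hz, rfl⟩
    rw [key]
    exact Finset.sum_nonneg fun i _ => Finset.sum_nonneg fun j _ =>
      mul_nonneg (hz i j) (sub_nonneg.2 (hy i j))

theorem exists_minimal_rel {α : Type*} [Finite α] {R : α → α → Prop} (hrefl : ∀ a, R a a)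
    (htrans : ∀ a b c, R a b → R b c → R a c) (a : α) :
    ∃ p, R p a ∧ ∀ k, R k p → R p k := by
  let _ : Preorder α := { le := R, le_refl := hrefl, le_trans := htrans }
  obtain ⟨p, hpa, hp⟩ := Set.Finite.exists_le_minimal (Set.toFinite (Set.univ : Set α))
    (Set.mem_univ a)
  exact ⟨p, hpa, fun k hk => hp.2 (Set.mem_univ k) hk⟩

/-- In a connected preorder that is not a single equivalence class, every element
lies below a non-minimal one. -/
theorem exists_rel_not_minimal {α : Type*} {R : α → α → Prop} (hrefl : ∀ a, R a a)
    (htrans : ∀ a b c, R a b → R b c → R a c)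
    (hconn : ∀ C : Set α, C.Nonempty → (∀ a b, R a b → (a ∈ C ↔ b ∈ C)) → C = Set.univ)
    (hnot : ∃ a b, ¬ R a b) (p : α) :
    ∃ n, R p n ∧ ¬ ∀ k, R k n → R n k := by
  by_contra! hcon
  have hC : {k | R p k} = Set.univ := by
    refine hconn _ ⟨p, hrefl p⟩ fun a b hab => ⟨fun ha => htrans _ _ _ ha hab, fun hb => ?_⟩
    exact htrans _ _ _ hb (hcon b hb a hab)
  have hall : ∀ k, R p k := fun k => by
    have : k ∈ {k | R p k} := hC ▸ Set.mem_univ k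
    exact this
  obtain ⟨a, b, hab⟩ := hnot
  exact hab (htrans _ _ _ (hcon a (hall a) p (hall a)) (hall b))

/-- The comparabilities between minimal and non-minimal elements already connect a connected
finite preorder that is not a single equivalence class. -/
theorem connected_fromRel_minimal {α : Type*} [Finite α] [Nonempty α] {R : α → α → Prop}
    (hrefl : ∀ a, R a a) (htrans : ∀ a b c, R a b → R b c → R a c)
    (hconn : ∀ C : Set α, C.Nonempty → (∀ a b, R a b → (a ∈ C ↔ b ∈ C)) → C = Set.univ)
    (hnot : ∃ a b, ¬ R a b) :
    (SimpleGraph.fromRel fun a b =>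
      (∀ k, R k a → R a k) ∧ (¬ ∀ k, R k b → R b k) ∧ R a b).Connected := by
  set G := SimpleGraph.fromRel fun a b =>
      (∀ k, R k a → R a k) ∧ (¬ ∀ k, R k b → R b k) ∧ R a b with hG
  have hadj : ∀ a b, (∀ k, R k a → R a k) → (¬ ∀ k, R k b → R b k) → R a b →
      G.Reachable a b := by
    intro a b ha hb hab
    apply SimpleGraph.Adj.reachable
    rw [hG, SimpleGraph.fromRel_adj]
    exact ⟨fun h => hb (h ▸ ha), Or.inl ⟨ha, hb, hab⟩⟩
  have hreach : ∀ a b, R a b → G.Reachable a b := by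
    intro a b hab
    by_cases hb : ∀ k, R k b → R b k
    · have hba := hb a hab
      have ha : ∀ k, R k a → R a k := fun k hk =>
        htrans _ _ _ hab (hb k (htrans _ _ _ hk hab))
      obtain ⟨n, hbn, hn⟩ := exists_rel_not_minimal hrefl htrans hconn hnot b
      exact (hadj a n ha hn (htrans _ _ _ hab hbn)).trans (hadj b n hb hn hbn).symm
    · by_cases ha : ∀ k, R k a → R a k
      · exact hadj a b ha hb hab
      · obtain ⟨p, hpa, hp⟩ := exists_minimal_rel hrefl htrans a
        exact (hadj p a hp ha hpa).symm.trans (hadj p b hp hb (htrans _ _ _ hpa hab))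
  refine ⟨fun a b => ?_⟩
  have hC : {k | G.Reachable a k} = Set.univ :=
    hconn _ ⟨a, SimpleGraph.Reachable.refl a⟩ fun k l hkl =>
      ⟨fun h => h.trans (hreach k l hkl), fun h => h.trans (hreach k l hkl).symm⟩
  have : b ∈ {k | G.Reachable a k} := hC ▸ Set.mem_univ b
  exact this

section

variable {d : ℕ} {π : Fin d → Fin d → ℝ} {y : Fin d → ℝ}

theorem exists_tight_fails (h4 : ∃ i j k, π i j < π i k * π k j) (hpos : ∀ i, 0 < y i) :
    ∃ i j, ¬ π i j * y i = y j := by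
  by_contra! h
  obtain ⟨i, j, k, hlt⟩ := h4
  have e1 := h i j
  rw [← h k j, ← h i k] at e1
  have := mul_lt_mul_of_pos_right hlt (hpos i)
  linarith

theorem pos_of_mem_dualCone_s3 (h1 : ∀ i, π i i = 1) (h2 : ∀ i j, 0 < π i j)
    (h3 : ∀ i j k, π i j ≤ π i k * π k j) (h4 : ∃ i j k, π i j < π i k * π k j)
    (hy : ∀ i j, y j ≤ π i j * y i) (hne : y ≠ 0) (i : Fin d) : 0 < y i := by
  have hnonneg : ∀ i, 0 ≤ y i := by
    intro i
    by_contra! hi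
    have hneg : ∀ j, y j < 0 := fun j => (hy i j).trans_lt (mul_neg_of_pos_of_neg (h2 i j) hi)
    obtain ⟨a, b, hab⟩ := exists_tight_fails (y := -y) h4 fun j => neg_pos.2 (hneg j)
    refine hab (le_antisymm (by simpa using hy a b) ?_)
    have e1 := mul_le_mul_of_nonneg_left (hy b a) (h2 a b).le
    have e2 := h3 b b a
    rw [h1] at e2
    have e3 := mul_le_mul_of_nonpos_right e2 (hneg b).le
    simp only [Pi.neg_apply]
    linarith
  by_contra! hi
  have hi0 : y i = 0 := le_antisymm hi (hnonneg i)
  exact hne (funext fun j => le_antisymm (by simpa [hi0] using hy i j) (hnonneg j))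

theorem eventually_add_smul_mem {w : Fin d → ℝ} (hy : ∀ i j, y j ≤ π i j * y i)
    (hw : ∀ i j, π i j * y i = y j → π i j * w i = w j) :
    ∀ᶠ ε in 𝓝 (0 : ℝ), ∀ i j, y j + ε * w j ≤ π i j * (y i + ε * w i) := by
  refine eventually_all.2 fun i => eventually_all.2 fun j => ?_
  by_cases h : π i j * y i = y j
  · refine Eventually.of_forall fun ε => le_of_eq ?_
    rw [← h, ← hw i j h]
    ring
  · have hlt : y j < π i j * y i := lt_of_le_of_ne (hy i j) (Ne.symm h)
    have hl : Tendsto (fun ε : ℝ => y j + ε * w j) (𝓝 0) (𝓝 (y j)) := by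
      have : Continuous fun ε : ℝ => y j + ε * w j := by fun_prop
      simpa using this.tendsto 0
    have hr : Tendsto (fun ε : ℝ => π i j * (y i + ε * w i)) (𝓝 0) (𝓝 (π i j * y i)) := by
      have : Continuous fun ε : ℝ => π i j * (y i + ε * w i) := by fun_prop
      simpa using this.tendsto 0
    exact (hl.eventually_lt hr hlt).mono fun _ h => h.le

/-- The graph of tight constraints of an extreme direction is connected. -/
theorem IsExtremeDir.eq_univ_of_tight_closed
    (hext : IsExtremeDir d (dualCone d (solvencyCone d π)) y) (hpos : ∀ i, 0 < y i)
    {C : Set (Fin d)} (hC : C.Nonempty)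
    (hclosed : ∀ i j, π i j * y i = y j → (i ∈ C ↔ j ∈ C)) : C = Set.univ := by
  classical
  obtain ⟨hyK, -, hdec⟩ := hext
  rw [mem_dualCone_solvencyCone] at hyK
  by_contra hne
  obtain ⟨c, hc⟩ := hC
  obtain ⟨b, hb⟩ := (Set.ne_univ_iff_exists_notMem C).1 hne
  set w : Fin d → ℝ := fun k => if k ∈ C then y k else 0 with hw
  have hwt : ∀ i j, π i j * y i = y j → π i j * w i = w j := by
    intro i j hij
    by_cases hi : i ∈ C
    · simp [hw, hi, (hclosed i j hij).1 hi, hij]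
    · have hj : j ∉ C := fun hj => hi ((hclosed i j hij).2 hj)
      simp [hw, hi, hj]
  have hplus := eventually_add_smul_mem hyK hwt
  have hminus := eventually_add_smul_mem (w := -w) hyK fun i j hij => by
    simpa using hwt i j hij
  obtain ⟨ε, ⟨hp, hm⟩, hε⟩ := (((hplus.and hminus).filter_mono
    (nhdsWithin_le_nhds (s := Set.Ioi 0))).and self_mem_nhdsWithin).exists
  have hε' : 0 < ε := hε
  set u : Fin d → ℝ := fun k => 1 / 2 * (y k + ε * w k) with hu
  set v : Fin d → ℝ := fun k => 1 / 2 * (y k - ε * w k) with hv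
  have hwc : w c = y c := by simp [hw, hc]
  have hwb : w b = 0 := by simp [hw, hb]
  have hyc := hpos c
  have hyb := hpos b
  have hprod : 0 < ε * y c := mul_pos hε' hyc
  have hcases := hdec u v
    (mem_dualCone_solvencyCone.2 fun i j => by
      have := hp i j
      simp only [hu]
      linarith)
    (mem_dualCone_solvencyCone.2 fun i j => by
      have := hm i j
      simp only [Pi.neg_apply] at this
      simp only [hv]
      linarith)
    (fun h => by
      have := congrFun h b
      simp only [hu, hwb, Pi.zero_apply] at this
      linarith)
    (fun h => by
      have := congrFun h b
      simp only [hv, hwb, Pi.zero_apply] at this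
      linarith)
    (funext fun k => by
      simp only [hu, hv, Pi.add_apply]
      ring)
  rcases hcases with ⟨α, -, h⟩ | ⟨α, -, h⟩
  all_goals
    have eb := congrFun h b
    have ec := congrFun h c
    simp only [hu, hv, hwb, hwc, Pi.smul_apply, smul_eq_mul, mul_zero, add_zero, sub_zero]
      at eb ec
    have hα : α = 1 / 2 := (mul_right_cancel₀ hyb.ne' eb).symm
    rw [hα] at ec
    linarith

theorem exists_isFeasibleTreeSolution (hd : 2 ≤ d) (h1 : ∀ i, π i i = 1)
    (h2 : ∀ i j, 0 < π i j) (h3 : ∀ i j k, π i j ≤ π i k * π k j)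
    (h4 : ∃ i j k, π i j < π i k * π k j)
    (hext : IsExtremeDir d (dualCone d (solvencyCone d π)) y) :
    ∃ P N : Finset (Fin d), IsBipartition d P N ∧ IsFeasibleTreeSolution d π P N y := by
  classical
  have hyK := mem_dualCone_solvencyCone.1 hext.1
  have hpos := pos_of_mem_dualCone_s3 h1 h2 h3 h4 hyK hext.2.1
  let R : Fin d → Fin d → Prop := fun i j => π i j * y i = y j
  have hrefl : ∀ i, R i i := fun i => by simp [R, h1]
  have htrans : ∀ i j k, R i j → R j k → R i k := by
    intro i j k hij hjk
    refine le_antisymm ?_ (hyK i k)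
    rw [← hjk, ← hij]
    have := mul_le_mul_of_nonneg_right (h3 i k j) (hpos i).le
    linarith
  have hconn : ∀ C : Set (Fin d), C.Nonempty → (∀ a b, R a b → (a ∈ C ↔ b ∈ C)) →
      C = Set.univ := fun C hC h => hext.eq_univ_of_tight_closed hpos hC h
  have hnot : ∃ i j, ¬ R i j := exists_tight_fails h4 hpos
  have hne : Nonempty (Fin d) := ⟨⟨0, by omega⟩⟩
  obtain ⟨p, -, hp⟩ := exists_minimal_rel hrefl htrans hne.some
  obtain ⟨n, -, hn⟩ := exists_rel_not_minimal hrefl htrans hconn hnot p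
  obtain ⟨F, hFle, hF⟩ := (connected_fromRel_minimal hrefl htrans hconn hnot).exists_isTree_le
  refine ⟨Finset.univ.filter fun i => ∀ k, R k i → R i k,
    Finset.univ.filter fun i => ¬ ∀ k, R k i → R i k,
    ⟨⟨p, by simpa using hp⟩, ⟨n, by simpa using hn⟩, Finset.disjoint_filter_filter_not _ _ _,
      Finset.filter_union_filter_not_eq _ _⟩,
    {a | F.Adj a.1 a.2 ∧ (∀ k, R k a.1 → R a.1 k) ∧ (¬ ∀ k, R k a.2 → R a.2 k) ∧ R a.1 a.2},
    ⟨?_, ?_⟩, ?_, ?_⟩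
  · rintro ⟨a, b⟩ ⟨-, ha, hb, -⟩
    exact ⟨Finset.mem_filter.2 ⟨Finset.mem_univ _, ha⟩,
      Finset.mem_filter.2 ⟨Finset.mem_univ _, hb⟩⟩
  · convert hF using 1
    ext a b
    rw [SimpleGraph.fromRel_adj]
    constructor
    · rintro ⟨-, h | h⟩
      · exact h.1
      · exact h.1.symm
    · intro h
      obtain ⟨hab, h' | h'⟩ := (SimpleGraph.fromRel_adj _ _ _).1 (hFle h)
      · exact ⟨hab, Or.inl ⟨h, h'⟩⟩
      · exact ⟨hab, Or.inr ⟨h.symm, h'⟩⟩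
  · rintro ⟨a, b⟩ ⟨-, -, -, h⟩
    exact ⟨h, hpos b⟩
  · exact fun i _ j _ => ⟨hyK i j, hpos j⟩

theorem IsFeasibleTreeSolution.isExtremeDir (hd : 2 ≤ d) (h1 : ∀ i, π i i = 1)
    (h2 : ∀ i j, 0 < π i j) (h3 : ∀ i j k, π i j ≤ π i k * π k j)
    (h4 : ∃ i j k, π i j < π i k * π k j) {P N : Finset (Fin d)} (hPN : IsBipartition d P N)
    (hy : IsFeasibleTreeSolution d π P N y) :
    IsExtremeDir d (dualCone d (solvencyCone d π)) y := by
  obtain ⟨⟨p, hp⟩, ⟨n, hn⟩, hdisj, hunion⟩ := hPN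
  obtain ⟨T, ⟨hTE, hT⟩, hgen, hfeas⟩ := hy
  have hmem : ∀ i, i ∈ P ∨ i ∈ N := fun i => by
    rw [← Finset.mem_union, hunion]
    exact Finset.mem_univ i
  have hpos : ∀ i, 0 < y i := by
    intro i
    rcases hmem i with hi | hi
    · have h := hfeas i hi n hn
      exact pos_of_mul_pos_right (h.2.trans_le h.1) (h2 i n).le
    · exact (hfeas p hp i hi).2
  have : Nontrivial (Fin d) := Fin.nontrivial_iff_two_le.2 hd
  have hinc : ∀ i, ∃ j, (i, j) ∈ T ∨ (j, i) ∈ T := fun i => by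
    obtain ⟨j, hj⟩ := hT.1.preconnected.exists_adj_of_nontrivial i
    exact ⟨j, ((SimpleGraph.fromRel_adj _ _ _).1 hj).2⟩
  have hP : ∀ i ∈ P, ∃ j ∈ N, π i j * y i = y j := by
    intro i hi
    obtain ⟨j, h | h⟩ := hinc i
    · exact ⟨j, (hTE h).2, (hgen _ h).1⟩
    · exact absurd (hTE h).2 (Finset.disjoint_left.1 hdisj hi)
  have hN : ∀ j ∈ N, ∃ i ∈ P, π i j * y i = y j := by
    intro j hj
    obtain ⟨i, h | h⟩ := hinc j
    · exact absurd hj (Finset.disjoint_left.1 hdisj (hTE h).1)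
    · exact ⟨i, (hTE h).1, (hgen _ h).1⟩
  have hPto : ∀ i ∈ P, ∀ j, y j ≤ π i j * y i := by
    intro i hi j
    rcases hmem j with hj | hj
    · obtain ⟨n, hn, e⟩ := hP j hj
      have a1 := (hfeas i hi n hn).1
      have a2 := mul_le_mul_of_nonneg_right (h3 i n j) (hpos i).le
      refine le_of_mul_le_mul_left ?_ (h2 j n)
      linarith
    · exact (hfeas i hi j hj).1
  have hyK : ∀ i j, y j ≤ π i j * y i := by
    intro i j
    rcases hmem i with hi | hi
    · exact hPto i hi j
    · obtain ⟨p, hp, e⟩ := hN i hi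
      have a1 := hPto p hp j
      have a2 := mul_le_mul_of_nonneg_right (h3 p j i) (hpos p).le
      rw [← e]
      linarith
  refine ⟨mem_dualCone_solvencyCone.2 hyK, fun h => (hpos p).ne' (congrFun h p), ?_⟩
  intro u v hu hv hu0 _ huv
  rw [mem_dualCone_solvencyCone] at hu hv
  have hupos := pos_of_mem_dualCone_s3 h1 h2 h3 h4 hu hu0
  have htight : ∀ i j, (i, j) ∈ T → u i / y i = u j / y j := by
    intro i j hij
    have e := (hgen _ hij).1
    simp only at e
    have e' := e
    simp only [huv, Pi.add_apply] at e'
    have eu : π i j * u i = u j := by linarith [hu i j, hv i j]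
    rw [← e, ← eu, mul_div_mul_left _ _ (h2 i j).ne']
  have hconst : ∀ k, u p / y p = u k / y k := by
    intro k
    have hr := (SimpleGraph.reachable_iff_reflTransGen _ _).1 (hT.1.preconnected p k)
    induction hr with
    | refl => rfl
    | tail _ hab ih =>
      rcases ((SimpleGraph.fromRel_adj _ _ _).1 hab).2 with h | h
      · exact ih.trans (htight _ _ h)
      · exact ih.trans (htight _ _ h).symm
  refine Or.inl ⟨u p / y p, div_pos (hupos p) (hpos p), funext fun k => ?_⟩
  rw [hconst k, Pi.smul_apply, smul_eq_mul, div_mul_cancel₀ _ (hpos k).ne']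

end

/-- Theorem 3: `y` is an extreme direction of `K_d^+` iff `y` is a feasible tree
solution with respect to some bipartition `(P, N)` of `V`. -/
theorem extremeDir_iff_feasibleTreeSolution (d : ℕ) (hd : 2 ≤ d) (π : Fin d → Fin d → ℝ)
    (h1 : ∀ i, π i i = 1)
    (h2 : ∀ i j, 0 < π i j)
    (h3 : ∀ i j k, π i j ≤ π i k * π k j)
    (h4 : ∃ i j k, π i j < π i k * π k j)
    (y : Fin d → ℝ) :
    IsExtremeDir d (dualCone d (solvencyCone d π)) y ↔
      ∃ P N : Finset (Fin d), IsBipartition d P N ∧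
        IsFeasibleTreeSolution d π P N y := by
  constructor
  · exact exists_isFeasibleTreeSolution hd h1 h2 h3 h4
  · rintro ⟨P, N, hPN, hy⟩
    exact hy.isExtremeDir hd h1 h2 h3 h4 hPN
end
end

section
/- Let H be a bipartite graph with bipartition (P,N). Then the number of distinct left degree sequences arising from spanning trees of H equals the number of distinct right degree sequences arising from spanning trees of H: |{ deg_T(P) : T spanning tree of H }| = |{ deg_T(N) : T spanning tree of H }|. -/
noncomputable section

/-- `T` is (the edge set of) a spanning tree of the bipartite graph on `L ⊕ R`
with edge set `H ⊆ L × R`: `T ⊆ H` and the corresponding simple graph on `L ⊕ R`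
is connected and acyclic. -/
def IsSpanningTreeBip {L R : Type} (H T : Set (L × R)) : Prop :=
  T ⊆ H ∧ (SimpleGraph.fromRel (fun u v : L ⊕ R =>
    ∃ p ∈ T, u = Sum.inl p.1 ∧ v = Sum.inr p.2)).IsTree

section Aux
open scoped Classical
variable {L R : Type}

/-- The simple graph on `L ⊕ R` with edge set `T`. -/
def bipGraph (T : Set (L × R)) : SimpleGraph (L ⊕ R) :=
  SimpleGraph.fromRel (fun u v : L ⊕ R => ∃ p ∈ T, u = Sum.inl p.1 ∧ v = Sum.inr p.2)

lemma bipGraph_adj_inl_inr {T : Set (L × R)} {i : L} {j : R} :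
    (bipGraph T).Adj (Sum.inl i) (Sum.inr j) ↔ (i, j) ∈ T := by
  simp [bipGraph, SimpleGraph.fromRel_adj]

lemma not_bipGraph_adj_inl_inl {T : Set (L × R)} {i i' : L} :
    ¬ (bipGraph T).Adj (Sum.inl i) (Sum.inl i') := by
  simp [bipGraph, SimpleGraph.fromRel_adj]

lemma not_bipGraph_adj_inr_inr {T : Set (L × R)} {j j' : R} :
    ¬ (bipGraph T).Adj (Sum.inr j) (Sum.inr j') := by
  simp [bipGraph, SimpleGraph.fromRel_adj]

lemma bipGraph_adj_inr_inl {T : Set (L × R)} {i : L} {j : R} :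
    (bipGraph T).Adj (Sum.inr j) (Sum.inl i) ↔ (i, j) ∈ T := by
  rw [SimpleGraph.adj_comm, bipGraph_adj_inl_inr]

lemma card_edgeSet_bipGraph (T : Set (L × R)) :
    Nat.card (bipGraph T).edgeSet = T.ncard := by
  have hinj : Function.Injective
      (fun p : L × R => (s(Sum.inl p.1, Sum.inr p.2) : Sym2 (L ⊕ R))) := by
    rintro ⟨a, b⟩ ⟨c, d⟩ h
    simpa using h
  have : (bipGraph T).edgeSet =
      (fun p : L × R => (s(Sum.inl p.1, Sum.inr p.2) : Sym2 (L ⊕ R))) '' T := by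
    ext e
    induction e with | _ u v
    rcases u with i | j <;> rcases v with i' | j' <;>
      simp [not_bipGraph_adj_inl_inl, not_bipGraph_adj_inr_inr, bipGraph_adj_inl_inr,
        bipGraph_adj_inr_inl]
  rw [Nat.card_coe_set_eq, this, Set.ncard_image_of_injective _ hinj]

/-- In a tree rooted at `r`, every other vertex has exactly one neighbour closer to the root. -/
lemma SimpleGraph.IsTree.existsUnique_adj_dist_lt {V : Type*} {G : SimpleGraph V}
    (hG : G.IsTree) {r v : V} (hv : v ≠ r) : ∃! w, G.Adj w v ∧ G.dist r w < G.dist r v := by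
  obtain ⟨p, hp, hlen⟩ := hG.connected.exists_path_of_dist r v
  have key : ∀ w, G.Adj w v → G.dist r w < G.dist r v → w = p.penultimate := by
    intro w hw hlt
    obtain ⟨q, hq, hqlen⟩ := hG.connected.exists_path_of_dist r w
    have hle : G.dist r v ≤ (q.concat hw).length := SimpleGraph.dist_le _
    have hlen' : (q.concat hw).length = G.dist r v := by
      rw [SimpleGraph.Walk.length_concat] at hle ⊢
      omega
    have hpath := SimpleGraph.Walk.isPath_of_length_eq_dist _ hlen'
    have := (hG.existsUnique_path r v).unique hpath hp
    rw [← this, SimpleGraph.Walk.penultimate_concat]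
  have hnil : ¬ p.Nil := SimpleGraph.Walk.not_nil_of_ne hv.symm
  have hadj := p.adj_penultimate hnil
  refine ⟨p.penultimate, ⟨hadj, ?_⟩, fun w hw => key w hw.1 hw.2⟩
  have h1 : G.dist r p.penultimate ≤ p.dropLast.length := SimpleGraph.dist_le _
  have h2 := congrArg SimpleGraph.Walk.length (p.concat_dropLast hadj)
  rw [SimpleGraph.Walk.length_concat] at h2
  omega

/-- A vector is lexicographically nonnegative along a list of coordinates. -/
def LexNonneg {α : Type} : List α → (α → ℝ) → Prop
  | [], _ => True
  | e :: l, d => 0 < d e ∨ d e = 0 ∧ LexNonneg l d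

lemma LexNonneg.eq_zero {α : Type} {l : List α} {d : α → ℝ} (h : LexNonneg l d)
    (h' : LexNonneg l (-d)) : ∀ e ∈ l, d e = 0 := by
  induction l with
  | nil => simp
  | cons a l ih =>
    simp only [LexNonneg, Pi.neg_apply] at h h'
    have ha : d a = 0 := by
      rcases h with h | h <;> rcases h' with h' | h' <;> linarith
    simp only [ha, lt_irrefl, neg_zero, true_and, false_or] at h h'
    simp only [List.mem_cons, forall_eq_or_imp]
    exact ⟨ha, ih h h'⟩

lemma LexNonneg.of_smul {α : Type} {l : List α} {d : α → ℝ} {c : ℝ} (hc : 0 < c)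
    (h : LexNonneg l (c • d)) : LexNonneg l d := by
  induction l with
  | nil => trivial
  | cons a l ih =>
    simp only [LexNonneg, Pi.smul_apply, smul_eq_mul] at h ⊢
    rcases h with h | ⟨h, h'⟩
    · exact Or.inl (pos_of_mul_pos_right h hc.le)
    · exact Or.inr ⟨(mul_eq_zero.1 h).resolve_left hc.ne', ih h'⟩

lemma lexNonneg_map {α β : Type} (φ : α → β) (l : List α) (d : β → ℝ) :
    LexNonneg (l.map φ) d ↔ LexNonneg l (d ∘ φ) := by
  induction l with
  | nil => simp [LexNonneg]
  | cons a l ih => simp [LexNonneg, ih]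

lemma IsCompact.exists_lexNonneg_sub {α : Type} (l : List α) {K : Set (α → ℝ)}
    (hK : IsCompact K) (hne : K.Nonempty) : ∃ x ∈ K, ∀ y ∈ K, LexNonneg l (y - x) := by
  induction l generalizing K with
  | nil =>
    obtain ⟨x, hx⟩ := hne
    exact ⟨x, hx, fun _ _ => trivial⟩
  | cons a l ih =>
    obtain ⟨z, hz, hmin⟩ := hK.exists_isMinOn hne (continuous_apply a).continuousOn
    obtain ⟨x, ⟨hxK, hxa⟩, hx⟩ := ih (K := K ∩ {x | x a = z a})
      (hK.inter_right (isClosed_eq (continuous_apply a) continuous_const)) ⟨z, hz, rfl⟩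
    refine ⟨x, hxK, fun y hy => ?_⟩
    have hxa : x a = z a := hxa
    have hle : z a ≤ y a := hmin hy
    simp only [LexNonneg, Pi.sub_apply, hxa]
    rcases hle.lt_or_eq with h | h
    · exact Or.inl (sub_pos.2 h)
    · exact Or.inr ⟨sub_eq_zero.2 h.symm, hx y ⟨hy, h.symm⟩⟩

/-- The left degrees of the edge set `T`. -/
def leftDeg (T : Set (L × R)) (i : L) : ℕ := {a ∈ T | a.1 = i}.ncard

/-- The indicator of the edges of `T` that lead away from the root `r`. -/
def rootFlow (T : Set (L × R)) (r : L) (p : L × R) : ℝ :=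
  if p ∈ T ∧ (bipGraph T).dist (Sum.inl r) (Sum.inl p.1) <
    (bipGraph T).dist (Sum.inl r) (Sum.inr p.2) then 1 else 0

lemma sum_ite_of_existsUnique {α : Type} [Fintype α] {P : α → Prop}
    [DecidablePred P] (h : ∃! a, P a) :
    ∑ a, (if P a then (1 : ℝ) else 0) = 1 := by
  obtain ⟨a, ha, huniq⟩ := h
  have : ∀ b, P b ↔ b = a := fun b => ⟨huniq b, fun hb => hb ▸ ha⟩
  simp [this]

lemma leftDeg_eq_sum [Fintype R] (T : Set (L × R)) (i : L) :
    (leftDeg T i : ℝ) = ∑ j, if (i, j) ∈ T then (1 : ℝ) else 0 := by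
  have : {a ∈ T | a.1 = i} = (fun j => (i, j)) '' {j | (i, j) ∈ T} := by
    ext ⟨a, b⟩
    simp only [Set.mem_ofPred_eq, Set.mem_image, Prod.mk.injEq]
    constructor
    · rintro ⟨h, rfl⟩
      exact ⟨b, h, rfl, rfl⟩
    · rintro ⟨j, h, rfl, rfl⟩
      exact ⟨h, rfl⟩
  rw [leftDeg, this, Set.ncard_image_of_injective _ (Prod.mk_right_injective i),
    Set.ncard_eq_toFinset_card']
  simp

variable [Fintype L] [Fintype R]

omit [Fintype R] in
lemma sum_rootFlow_col {T : Set (L × R)} (hT : (bipGraph T).IsTree) (r : L) (j : R) :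
    ∑ i, rootFlow T r (i, j) = 1 := by
  obtain ⟨w, ⟨hw, hlt⟩, huniq⟩ := hT.existsUnique_adj_dist_lt (r := Sum.inl r) (v := Sum.inr j)
    (by simp)
  rcases w with i | j'
  · refine sum_ite_of_existsUnique (P := fun i => (i, j) ∈ T ∧
      (bipGraph T).dist (Sum.inl r) (Sum.inl i) < (bipGraph T).dist (Sum.inl r) (Sum.inr j))
      ⟨i, ⟨bipGraph_adj_inl_inr.1 hw, hlt⟩, fun i' hi' => ?_⟩
    exact Sum.inl.inj (huniq _ ⟨bipGraph_adj_inl_inr.2 hi'.1, hi'.2⟩)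
  · exact absurd hw not_bipGraph_adj_inr_inr

omit [Fintype L] in
lemma sum_rootFlow_row {T : Set (L × R)} (hT : (bipGraph T).IsTree) (r i : L) :
    ∑ j, rootFlow T r (i, j) = leftDeg T i - 1 + if i = r then 1 else 0 := by
  have hsplit : ∑ j, rootFlow T r (i, j) + ∑ j, (if (i, j) ∈ T ∧
      (bipGraph T).dist (Sum.inl r) (Sum.inr j) < (bipGraph T).dist (Sum.inl r) (Sum.inl i)
      then (1 : ℝ) else 0) = leftDeg T i := by
    rw [leftDeg_eq_sum, ← Finset.sum_add_distrib]
    refine Finset.sum_congr rfl fun j _ => ?_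
    by_cases h : (i, j) ∈ T
    · have := hT.dist_ne_of_adj (Sum.inl r) (bipGraph_adj_inl_inr.2 h)
      rcases lt_or_gt_of_ne this with h' | h' <;> simp [rootFlow, h, h', h'.not_gt]
    · simp [rootFlow, h]
  by_cases hi : i = r
  · subst hi
    simp at hsplit
    simp [hsplit]
  · obtain ⟨w, ⟨hw, hlt⟩, huniq⟩ := hT.existsUnique_adj_dist_lt (r := Sum.inl r)
      (v := Sum.inl i) (by simpa using hi)
    rcases w with i' | j
    · exact absurd hw not_bipGraph_adj_inl_inl
    · rw [sum_ite_of_existsUnique (P := fun j => (i, j) ∈ T ∧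
        (bipGraph T).dist (Sum.inl r) (Sum.inr j) < (bipGraph T).dist (Sum.inl r) (Sum.inl i))
        ⟨j, ⟨bipGraph_adj_inr_inl.1 hw, hlt⟩, fun j' hj' =>
        Sum.inr.inj (huniq _ ⟨bipGraph_adj_inr_inl.2 hj'.1, hj'.2⟩)⟩] at hsplit
      simp only [hi, if_false]
      linarith

/-- Nonnegative vectors supported on `T` with row sums `a` and column sums `b`. -/
structure IsFlow (T : Set (L × R)) (a : L → ℝ) (b : R → ℝ) (x : L × R → ℝ) : Prop where
  nonneg : ∀ p, 0 ≤ x p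
  eq_zero : ∀ p ∉ T, x p = 0
  row : ∀ i, ∑ j, x (i, j) = a i
  col : ∀ j, ∑ i, x (i, j) = b j

/-- The row sums, scaled by `|L|`, that single out left degree sequence `f`. -/
def supply (f : L → ℕ) (i : L) : ℝ := Fintype.card L * ((f i : ℝ) - 1) + 1

/-- The column sums used together with `supply`. -/
def demand (L R : Type) [Fintype L] (_ : R) : ℝ := Fintype.card L

lemma exists_pos_isFlow {T : Set (L × R)} (hT : (bipGraph T).IsTree) :
    ∃ x, IsFlow T (supply (leftDeg T)) (demand L R) x ∧ ∀ p ∈ T, 0 < x p := by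
  have hnn : ∀ r p, 0 ≤ rootFlow T r p := by
    intro r p
    unfold rootFlow
    split_ifs <;> norm_num
  refine ⟨fun p => ∑ r, rootFlow T r p, ⟨fun p => Finset.sum_nonneg fun r _ => hnn r p,
    fun p hp => Finset.sum_eq_zero fun r _ => by simp [rootFlow, hp], fun i => ?_, fun j => ?_⟩,
    fun p hp => ?_⟩
  · rw [Finset.sum_comm]
    simp_rw [sum_rootFlow_row hT]
    simp [supply, Finset.sum_add_distrib, mul_sub]
  · rw [Finset.sum_comm]
    simp_rw [sum_rootFlow_col hT]
    simp [demand]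
  · refine Finset.sum_pos' (fun r _ => hnn r p) ⟨p.1, Finset.mem_univ _, ?_⟩
    have : 0 < (bipGraph T).dist (Sum.inl p.1) (Sum.inr p.2) :=
      hT.connected.pos_dist_of_ne (by simp)
    simp [rootFlow, hp, this]

lemma sum_cut (S : Set (L ⊕ R)) (x : L × R → ℝ) :
    ∑ i, (if Sum.inl i ∈ S then ∑ j, x (i, j) else 0) -
      ∑ j, (if Sum.inr j ∈ S then ∑ i, x (i, j) else 0) =
    ∑ p : L × R, x p *
      ((if Sum.inl p.1 ∈ S then 1 else 0) - (if Sum.inr p.2 ∈ S then 1 else 0)) := by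
  simp_rw [mul_sub, Finset.sum_sub_distrib, mul_ite, mul_one, mul_zero]
  congr 1
  · rw [Fintype.sum_prod_type]
    refine Finset.sum_congr rfl fun i _ => ?_
    split_ifs <;> simp
  · rw [Fintype.sum_prod_type_right]
    refine Finset.sum_congr rfl fun j _ => ?_
    split_ifs <;> simp

lemma sum_row_eq_sum_col (x : L × R → ℝ) : ∑ i, ∑ j, x (i, j) = ∑ j, ∑ i, x (i, j) :=
  Finset.sum_comm

/-- The support of a flow with marginals `supply f`, `demand` is connected. -/
lemma connected_of_isFlow [Nonempty L] {T : Set (L × R)} {f : L → ℕ} {x : L × R → ℝ}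
    (hx : IsFlow T (supply f) (demand L R) x) : (bipGraph T).Connected := by
  have key : ∀ (v : L ⊕ R) (i : L), (bipGraph T).Reachable v (Sum.inl i) := by
    intro v
    set S : Set (L ⊕ R) := {w | (bipGraph T).Reachable v w} with hS
    have h0 := sum_cut S x
    rw [Finset.sum_eq_zero (s := Finset.univ) (f := fun p : L × R => x p * _)] at h0
    swap
    · rintro ⟨i, j⟩ -
      by_cases h : (i, j) ∈ T
      · have hadj := (bipGraph_adj_inl_inr.2 h).reachable
        have : Sum.inl i ∈ S ↔ Sum.inr j ∈ S :=
          ⟨fun h => SimpleGraph.Reachable.trans h hadj,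
            fun h => SimpleGraph.Reachable.trans h hadj.symm⟩
        by_cases hj : Sum.inr j ∈ S <;> simp [this, hj]
      · simp [hx.eq_zero _ h]
    simp_rw [hx.row, hx.col, supply, demand] at h0
    set A : Finset L := Finset.univ.filter fun i => Sum.inl i ∈ S with hA
    set B : Finset R := Finset.univ.filter fun j => Sum.inr j ∈ S with hB
    rw [← Finset.sum_filter, ← Finset.sum_filter, ← hA, ← hB, Finset.sum_add_distrib,
      ← Finset.mul_sum] at h0
    simp only [Finset.sum_const, nsmul_eq_mul, mul_one] at h0
    have hdvd : (Fintype.card L : ℤ) ∣ A.card := by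
      refine ⟨B.card - ∑ i ∈ A, ((f i : ℤ) - 1), ?_⟩
      have : ((A.card : ℤ) : ℝ) = ((Fintype.card L *
          (B.card - ∑ i ∈ A, ((f i : ℤ) - 1)) : ℤ) : ℝ) := by
        push_cast
        linarith
      exact_mod_cast this
    have hApos : 0 < A.card := by
      rw [Nat.pos_iff_ne_zero]
      intro h
      have hm : (Fintype.card L : ℝ) ≠ 0 := by simp
      rw [Finset.card_eq_zero] at h
      have hB0 : B = ∅ := by simpa [h, hm] using h0
      have hv : v ∈ S := SimpleGraph.Reachable.refl v
      rcases v with i | j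
      · have : i ∈ A := by simp [hA, hv]
        simp [h] at this
      · have : j ∈ B := by simp [hB, hv]
        simp [hB0] at this
    have hAuniv : A = Finset.univ := by
      rw [← Finset.card_eq_iff_eq_univ]
      exact le_antisymm (Finset.card_le_univ A)
        (Nat.le_of_dvd hApos (Int.natCast_dvd_natCast.1 hdvd))
    intro i
    have : i ∈ A := by simp [hAuniv]
    simpa [hA, hS] using this
  obtain ⟨i⟩ := ‹Nonempty L›
  have : Nonempty (L ⊕ R) := ⟨Sum.inl i⟩
  exact ⟨fun v w => (key v i).trans (key w i).symm⟩

/-- The value of a flow on a tree edge depends on the marginals on one side of the edge. -/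
lemma IsFlow.eq_cut {T : Set (L × R)} {a : L → ℝ} {b : R → ℝ} {x : L × R → ℝ}
    (hx : IsFlow T a b x) {e : L × R} {S : Set (L ⊕ R)}
    (h1 : Sum.inl e.1 ∈ S) (h2 : Sum.inr e.2 ∉ S)
    (h3 : ∀ p ∈ T, p ≠ e → (Sum.inl p.1 ∈ S ↔ Sum.inr p.2 ∈ S)) :
    x e = ∑ i, (if Sum.inl i ∈ S then a i else 0) - ∑ j, (if Sum.inr j ∈ S then b j else 0) := by
  have h0 := sum_cut S x
  simp_rw [hx.row, hx.col] at h0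
  rw [h0, Finset.sum_eq_single e]
  · simp [h1, h2]
  · intro p _ hp
    by_cases h : p ∈ T
    · by_cases hj : Sum.inr p.2 ∈ S <;> simp [h3 p h hp, hj]
    · simp [hx.eq_zero p h]
  · simp

omit [Fintype L] [Fintype R] in
lemma exists_cut_of_isTree {T : Set (L × R)} (hT : (bipGraph T).IsTree) {e : L × R}
    (he : e ∈ T) : ∃ S : Set (L ⊕ R), Sum.inl e.1 ∈ S ∧ Sum.inr e.2 ∉ S ∧
      ∀ p ∈ T, p ≠ e → (Sum.inl p.1 ∈ S ↔ Sum.inr p.2 ∈ S) := by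
  have hb := SimpleGraph.isAcyclic_iff_forall_adj_isBridge.1 hT.isAcyclic
    (bipGraph_adj_inl_inr.2 he)
  rw [SimpleGraph.isBridge_iff] at hb
  refine ⟨{w | ((bipGraph T).deleteEdges {s(Sum.inl e.1, Sum.inr e.2)}).Reachable
    (Sum.inl e.1) w}, SimpleGraph.Reachable.refl _, hb, fun p hp hne => ?_⟩
  have hadj : ((bipGraph T).deleteEdges {s(Sum.inl e.1, Sum.inr e.2)}).Adj
      (Sum.inl p.1) (Sum.inr p.2) := by
    rw [SimpleGraph.deleteEdges_adj]
    refine ⟨bipGraph_adj_inl_inr.2 hp, fun h => hne ?_⟩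
    simpa [Prod.ext_iff] using h
  exact ⟨fun h => SimpleGraph.Reachable.trans h hadj.reachable,
    fun h => SimpleGraph.Reachable.trans h hadj.reachable.symm⟩

lemma IsFlow.sum_supply [Nonempty L] {T : Set (L × R)} {f : L → ℕ} {x : L × R → ℝ}
    (hx : IsFlow T (supply f) (demand L R) x) :
    ∑ i, (f i : ℝ) = Fintype.card L + Fintype.card R - 1 := by
  have h := sum_row_eq_sum_col x
  simp_rw [hx.row, hx.col, supply, demand] at h
  rw [Finset.sum_add_distrib, ← Finset.mul_sum, Finset.sum_sub_distrib] at h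
  simp only [Finset.sum_const, nsmul_eq_mul, mul_one, Finset.card_univ] at h
  have hm : (Fintype.card L : ℝ) ≠ 0 := by simp
  apply mul_left_cancel₀ hm
  linarith

/-- A tree carrying a positive flow with row sums `supply f` has left degree sequence `f`. -/
lemma leftDeg_eq_of_isFlow [Nonempty L] {T : Set (L × R)} (hT : (bipGraph T).IsTree)
    {f : L → ℕ} {x : L × R → ℝ} (hx : IsFlow T (supply f) (demand L R) x)
    (hpos : ∀ p ∈ T, 0 < x p) : leftDeg T = f := by
  obtain ⟨y, hy, -⟩ := exists_pos_isFlow hT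
  have hm : (0 : ℝ) < Fintype.card L := by simp [Fintype.card_pos]
  have hedge : ∀ e, y e ≤ x e := by
    intro e
    by_cases he : e ∈ T
    swap
    · rw [hx.eq_zero e he, hy.eq_zero e he]
    obtain ⟨S, h1, h2, h3⟩ := exists_cut_of_isTree hT he
    have hxe := hx.eq_cut h1 h2 h3
    have hye := hy.eq_cut h1 h2 h3
    have hyle : y e ≤ Fintype.card L := by
      have := hy.col e.2
      rw [demand] at this
      rw [← this]
      exact Finset.single_le_sum (f := fun i => y (i, e.2)) (fun i _ => hy.nonneg _)
        (Finset.mem_univ e.1)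
    set k : ℤ := ∑ i, (if Sum.inl i ∈ S then (f i : ℤ) - leftDeg T i else 0) with hk
    have hdiff : x e - y e = Fintype.card L * (k : ℝ) := by
      rw [hxe, hye, sub_sub_sub_cancel_right, ← Finset.sum_sub_distrib, hk, Int.cast_sum,
        Finset.mul_sum]
      refine Finset.sum_congr rfl fun i _ => ?_
      split_ifs
      · simp only [supply]
        push_cast
        ring
      · simp
    have hk0 : 0 ≤ k := by
      have hlt : (Fintype.card L : ℝ) * (-1) < Fintype.card L * k := by
        have := hpos e he
        linarith
      have : (-1 : ℝ) < k := lt_of_mul_lt_mul_left hlt hm.le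
      have : (-1 : ℤ) < k := by exact_mod_cast this
      omega
    have : (0 : ℝ) ≤ k := by exact_mod_cast hk0
    nlinarith [mul_nonneg hm.le this]
  have hle : ∀ i, (leftDeg T i : ℝ) ≤ f i := by
    intro i
    have h : supply (leftDeg T) i ≤ supply f i := by
      rw [← hx.row, ← hy.row]
      exact Finset.sum_le_sum fun j _ => hedge _
    simp only [supply, add_le_add_iff_right, mul_le_mul_iff_right₀ hm] at h
    linarith
  have hsum : ∑ i, (leftDeg T i : ℝ) = ∑ i, (f i : ℝ) := by
    rw [hx.sum_supply, hy.sum_supply]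
  have := (Finset.sum_eq_sum_iff_of_le fun i _ => hle i).1 hsum
  ext i
  exact_mod_cast this i (Finset.mem_univ i)

/-- Signed vectors supported on `H` all of whose row and column sums vanish. -/
structure IsCirculation (H : Set (L × R)) (d : L × R → ℝ) : Prop where
  eq_zero : ∀ p ∉ H, d p = 0
  row : ∀ i, ∑ j, d (i, j) = 0
  col : ∀ j, ∑ i, d (i, j) = 0

lemma IsCirculation.neg {H : Set (L × R)} {d : L × R → ℝ} (hd : IsCirculation H d) :
    IsCirculation H (-d) :=
  ⟨fun p hp => by simp [hd.eq_zero p hp], fun i => by simp [hd.row i],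
    fun j => by simp [hd.col j]⟩

lemma IsFlow.isCirculation_sub {H T T' : Set (L × R)} {a : L → ℝ} {b : R → ℝ}
    {x y : L × R → ℝ} (hx : IsFlow T a b x) (hy : IsFlow T' a b y) (hT : T ⊆ H) (hT' : T' ⊆ H) :
    IsCirculation H (x - y) :=
  ⟨fun p hp => by simp [hx.eq_zero p fun h => hp (hT h), hy.eq_zero p fun h => hp (hT' h)],
    fun i => by simp [hx.row i, hy.row i], fun j => by simp [hx.col j, hy.col j]⟩

/-- A connected graph without nonzero circulations is a tree. -/
lemma isTree_of_connected_of_circulation [Nonempty L] {T : Set (L × R)}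
    (hconn : (bipGraph T).Connected) (hT : ∀ d, IsCirculation T d → d = 0) :
    (bipGraph T).IsTree := by
  let φ : ((T → ℝ) × ℝ) →ₗ[ℝ] (L ⊕ R → ℝ) :=
    { toFun := fun y => Sum.elim
        (fun i => ∑ j, Function.ExtendByZero.linearMap ℝ (Subtype.val : T → L × R) y.1 (i, j) + y.2)
        (fun j => ∑ i, Function.ExtendByZero.linearMap ℝ (Subtype.val : T → L × R) y.1 (i, j))
      map_add' := by
        intro y z
        ext (i | j)
        · simp only [Prod.fst_add, Prod.snd_add, map_add, Pi.add_apply, Sum.elim_inl,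
            Finset.sum_add_distrib]
          ring
        · simp only [Prod.fst_add, map_add, Pi.add_apply, Sum.elim_inr, Finset.sum_add_distrib]
      map_smul' := by
        intro c y
        ext (i | j)
        · simp only [Prod.smul_fst, Prod.smul_snd, map_smul, Pi.smul_apply, Sum.elim_inl,
            smul_eq_mul, Finset.mul_sum, RingHom.id_apply, mul_add]
        · simp only [Prod.smul_fst, map_smul, Pi.smul_apply, Sum.elim_inr,
            smul_eq_mul, Finset.mul_sum, RingHom.id_apply] }
  have hinj : Function.Injective φ := by
    rw [injective_iff_map_eq_zero]
    rintro ⟨y, c⟩ h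
    set d := Function.ExtendByZero.linearMap ℝ (Subtype.val : T → L × R) y with hd
    have hrow : ∀ i, ∑ j, d (i, j) + c = 0 := fun i => congrFun h (Sum.inl i)
    have hcol : ∀ j, ∑ i, d (i, j) = 0 := fun j => congrFun h (Sum.inr j)
    have hc : c = 0 := by
      have h1 : ∑ i, (∑ j, d (i, j) + c) = 0 := Finset.sum_eq_zero fun i _ => hrow i
      rw [Finset.sum_add_distrib, sum_row_eq_sum_col, Finset.sum_eq_zero fun j _ => hcol j] at h1
      simpa using h1
    have hd0 : d = 0 := by
      refine hT d ⟨fun p hp => ?_, fun i => by simpa [hc] using hrow i, hcol⟩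
      exact Function.extend_apply' _ _ _ (by rintro ⟨q, rfl⟩; exact hp q.2)
    refine Prod.ext (funext fun q => ?_) hc
    have := congrFun hd0 q.1
    exact (Subtype.val_injective.extend_apply y 0 q).symm.trans this
  have hcard := LinearMap.finrank_le_finrank_of_injective hinj
  rw [Module.finrank_prod, Module.finrank_fintype_fun_eq_card, Module.finrank_fintype_fun_eq_card,
    Module.finrank_self, ← Nat.card_eq_fintype_card, ← Nat.card_eq_fintype_card,
    Nat.card_coe_set_eq, ← card_edgeSet_bipGraph] at hcard
  exact SimpleGraph.isTree_iff_connected_and_card.2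
    ⟨hconn, le_antisymm hcard hconn.card_vert_le_card_edgeSet_add_one⟩

lemma isCompact_setOf_isFlow (H : Set (L × R)) (a : L → ℝ) (b : R → ℝ) :
    IsCompact {x | IsFlow H a b x} := by
  have hsub : {x | IsFlow H a b x} ⊆ Set.Icc 0 fun p => b p.2 := by
    refine fun x hx => ⟨fun p => hx.nonneg p, fun p => ?_⟩
    change x p ≤ b p.2
    rw [← hx.col p.2]
    exact Finset.single_le_sum (f := fun i => x (i, p.2)) (fun i _ => hx.nonneg _)
      (Finset.mem_univ p.1)
  refine isCompact_Icc.of_isClosed_subset ?_ hsub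
  have : {x | IsFlow H a b x} = {x | ∀ p, 0 ≤ x p} ∩ {x | ∀ p ∉ H, x p = 0} ∩
      {x | ∀ i, ∑ j, x (i, j) = a i} ∩ {x | ∀ j, ∑ i, x (i, j) = b j} := by
    ext x
    exact ⟨fun h => ⟨⟨⟨h.nonneg, h.eq_zero⟩, h.row⟩, h.col⟩,
      fun h => ⟨h.1.1.1, h.1.1.2, h.1.2, h.2⟩⟩
  rw [this]
  simp only [Set.ofPred_forall]
  refine (((isClosed_iInter fun p => ?_).inter (isClosed_iInter fun p => isClosed_iInter
    fun _ => ?_)).inter (isClosed_iInter fun i => ?_)).inter (isClosed_iInter fun j => ?_)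
  · exact isClosed_le continuous_const (continuous_apply p)
  · exact isClosed_eq (continuous_apply p) continuous_const
  · exact isClosed_eq (by fun_prop) continuous_const
  · exact isClosed_eq (by fun_prop) continuous_const

/-- The spanning trees of `H` that are optimal for the lexicographic order along `l`. These are
the simplices of a regular triangulation of the root polytope of `H`. -/
def IsLexTree (H : Set (L × R)) (l : List (L × R)) (T : Set (L × R)) : Prop :=
  IsSpanningTreeBip H T ∧
    ∀ d, IsCirculation H d → (∀ p ∉ T, 0 ≤ d p) → LexNonneg l d

lemma exists_pos_forall_add_smul_nonneg {α : Type} [Finite α] {x d : α → ℝ}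
    (hx : ∀ p, 0 ≤ x p) (hd : ∀ p, x p = 0 → 0 ≤ d p) :
    ∃ ε : ℝ, 0 < ε ∧ ∀ p, 0 ≤ (x + ε • d) p := by
  have h : ∀ᶠ ε : ℝ in nhdsWithin 0 (Set.Ioi 0), ∀ p, 0 ≤ (x + ε • d) p := by
    rw [Filter.eventually_all]
    intro p
    rcases (hx p).eq_or_lt with h0 | h0
    · filter_upwards [self_mem_nhdsWithin] with ε hε
      simpa [← h0] using mul_nonneg (le_of_lt hε) (hd p h0.symm)
    · have hc : Filter.Tendsto (fun ε : ℝ => (x + ε • d) p) (nhds 0) (nhds (x p)) := by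
        have : Continuous fun ε : ℝ => (x + ε • d) p := by
          simp only [Pi.add_apply, Pi.smul_apply]
          fun_prop
        simpa using this.tendsto 0
      exact ((hc.eventually (lt_mem_nhds h0)).filter_mono nhdsWithin_le_nhds).mono
        fun _ h => le_of_lt h
  obtain ⟨ε, hε, hpos⟩ := (h.and self_mem_nhdsWithin).exists
  exact ⟨ε, hpos, hε⟩

lemma exists_isLexTree [Nonempty L] {H : Set (L × R)} {l : List (L × R)} (hl : ∀ p, p ∈ l)
    {T₀ : Set (L × R)} (hT₀ : IsSpanningTreeBip H T₀) :
    ∃ T, IsLexTree H l T ∧ leftDeg T = leftDeg T₀ := by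
  obtain ⟨y, hy, -⟩ := exists_pos_isFlow hT₀.2
  obtain ⟨x, hx, hmin⟩ := (isCompact_setOf_isFlow H (supply (leftDeg T₀))
    (demand L R)).exists_lexNonneg_sub l
    ⟨y, hy.nonneg, fun p hp => hy.eq_zero p fun h => hp (hT₀.1 h), hy.row, hy.col⟩
  have hx : IsFlow H (supply (leftDeg T₀)) (demand L R) x := hx
  set T : Set (L × R) := {p | x p ≠ 0} with hT
  have hTH : T ⊆ H := fun p hp => by_contra fun h => hp (hx.eq_zero p h)
  have hxT : IsFlow T (supply (leftDeg T₀)) (demand L R) x :=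
    ⟨hx.nonneg, fun p hp => by simpa [hT] using hp, hx.row, hx.col⟩
  have hlex : ∀ d, IsCirculation H d → (∀ p ∉ T, 0 ≤ d p) → LexNonneg l d := by
    intro d hd hnn
    obtain ⟨ε, hε, hpos⟩ := exists_pos_forall_add_smul_nonneg hx.nonneg (d := d)
      fun p hp => hnn p (by simp [hT, hp])
    have := hmin (x + ε • d) ⟨hpos, fun p hp => by simp [hx.eq_zero p hp, hd.eq_zero p hp],
      fun i => by simp [Finset.sum_add_distrib, ← Finset.mul_sum, hx.row i, hd.row i],
      fun j => by simp [Finset.sum_add_distrib, ← Finset.mul_sum, hx.col j, hd.col j]⟩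
    rw [add_sub_cancel_left] at this
    exact this.of_smul hε
  have htree : (bipGraph T).IsTree := by
    refine isTree_of_connected_of_circulation (connected_of_isFlow hxT) fun d hd => ?_
    have hdH : IsCirculation H d := ⟨fun p hp => hd.eq_zero p fun h => hp (hTH h), hd.row, hd.col⟩
    have h1 := hlex d hdH fun p hp => (hd.eq_zero p hp).ge
    have h2 := hlex (-d) hdH.neg fun p hp => by simp [hd.eq_zero p hp]
    exact funext fun p => h1.eq_zero h2 p (hl p)
  exact ⟨T, ⟨⟨hTH, htree⟩, hlex⟩, leftDeg_eq_of_isFlow htree hxT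
    fun p hp => lt_of_le_of_ne (hx.nonneg p) (Ne.symm hp)⟩

lemma IsLexTree.eq_of_leftDeg_eq {H : Set (L × R)} {l : List (L × R)}
    (hl : ∀ p, p ∈ l) {T T' : Set (L × R)} (hT : IsLexTree H l T) (hT' : IsLexTree H l T')
    (h : leftDeg T = leftDeg T') : T = T' := by
  obtain ⟨x, hx, hxpos⟩ := exists_pos_isFlow hT.1.2
  obtain ⟨y, hy, hypos⟩ := exists_pos_isFlow hT'.1.2
  rw [← h] at hy
  have h1 := hT.2 _ (hy.isCirculation_sub hx hT'.1.1 hT.1.1)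
    fun p hp => by simpa [hx.eq_zero p hp] using hy.nonneg p
  have h2 := hT'.2 _ (hx.isCirculation_sub hy hT.1.1 hT'.1.1)
    fun p hp => by simpa [hy.eq_zero p hp] using hx.nonneg p
  rw [← neg_sub] at h2
  have hxy : ∀ p, y p = x p := fun p => sub_eq_zero.1 (h1.eq_zero h2 p (hl p))
  ext p
  constructor <;> intro hp <;> by_contra hp'
  · have := hxpos p hp
    rw [← hxy, hy.eq_zero p hp'] at this
    exact this.false
  · have := hypos p hp
    rw [hxy, hx.eq_zero p hp'] at this
    exact this.false

/-- Lexicographically optimal trees represent every left degree sequence exactly once. -/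
lemma ncard_setOf_isLexTree [Nonempty L] (H : Set (L × R)) {l : List (L × R)}
    (hl : ∀ p, p ∈ l) : {T | IsLexTree H l T}.ncard =
      {f : L → ℕ | ∃ T : Set (L × R), IsSpanningTreeBip H T ∧ f = leftDeg T}.ncard := by
  refine Set.BijOn.ncard_eq (f := leftDeg) ⟨fun T hT => ⟨T, hT.1, rfl⟩,
    fun T hT T' hT' h => hT.eq_of_leftDeg_eq hl hT' h, ?_⟩
  rintro f ⟨T₀, hT₀, rfl⟩
  obtain ⟨T, hT, h⟩ := exists_isLexTree hl hT₀
  exact ⟨T, hT, h⟩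

omit [Fintype L] [Fintype R] in
lemma IsSpanningTreeBip.swap {H T : Set (L × R)} (h : IsSpanningTreeBip H T) :
    IsSpanningTreeBip (Prod.swap ⁻¹' H) (Prod.swap ⁻¹' T) := by
  refine ⟨Set.preimage_mono h.1, ?_⟩
  let e : bipGraph T ≃g bipGraph (Prod.swap ⁻¹' T) :=
    { toEquiv := Equiv.sumComm L R
      map_rel_iff' := by
        rintro (i | j) (i' | j') <;>
          simp [not_bipGraph_adj_inl_inl, not_bipGraph_adj_inr_inr, bipGraph_adj_inl_inr,
            bipGraph_adj_inr_inl] }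
  exact e.isTree_iff.1 h.2

lemma IsLexTree.swap {H T : Set (L × R)} {l : List (L × R)} (h : IsLexTree H l T) :
    IsLexTree (Prod.swap ⁻¹' H) (l.map Prod.swap) (Prod.swap ⁻¹' T) := by
  refine ⟨h.1.swap, fun d hd hnn => ?_⟩
  rw [lexNonneg_map]
  exact h.2 _ ⟨fun p hp => hd.eq_zero _ (by simpa using hp), fun i => hd.col i,
    fun j => hd.row j⟩ fun p hp => hnn _ (by simpa using hp)

lemma ncard_setOf_isLexTree_swap (H : Set (L × R)) (l : List (L × R)) :
    {T | IsLexTree H l T}.ncard =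
      {T | IsLexTree (Prod.swap ⁻¹' H) (l.map Prod.swap) T}.ncard := by
  refine Set.BijOn.ncard_eq (f := fun T => Prod.swap ⁻¹' T) ⟨fun T hT => hT.swap,
    (Set.preimage_injective.2 Prod.swap_surjective).injOn, fun T hT => ⟨Prod.swap ⁻¹' T, ?_, ?_⟩⟩
  · simpa [← Set.preimage_comp] using IsLexTree.swap hT
  · simp [← Set.preimage_comp]

omit [Fintype L] [Fintype R] in
lemma leftDeg_swap (T : Set (L × R)) (j : R) :
    leftDeg (Prod.swap ⁻¹' T) j = {a ∈ T | a.2 = j}.ncard := by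
  rw [leftDeg, ← Set.ncard_image_of_injective {a ∈ T | a.2 = j} Prod.swap_injective,
    Set.image_swap_eq_preimage_swap]
  rfl

end Aux

/-- Lemma 4: for a bipartite graph `H` with (nonempty) parts `L` and `R`, the number
of left degree sequences of spanning trees of `H` equals the number of right degree
sequences of spanning trees of `H`. -/
theorem card_leftDegreeSequences_eq_card_rightDegreeSequences
    (L R : Type) [Fintype L] [Fintype R] [Nonempty L] [Nonempty R]
    (H : Set (L × R)) :
    {f : L → ℕ | ∃ T : Set (L × R), IsSpanningTreeBip H T ∧
        f = fun i => {a ∈ T | a.1 = i}.ncard}.ncard =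
    {g : R → ℕ | ∃ T : Set (L × R), IsSpanningTreeBip H T ∧
        g = fun j => {a ∈ T | a.2 = j}.ncard}.ncard := by
  have hl : ∀ p : L × R, p ∈ (Finset.univ : Finset (L × R)).toList := by simp
  have hl' : ∀ p : R × L, p ∈ ((Finset.univ : Finset (L × R)).toList).map Prod.swap := by
    rintro ⟨j, i⟩
    exact List.mem_map.2 ⟨(i, j), hl _, rfl⟩
  have hright : {g : R → ℕ | ∃ T : Set (L × R), IsSpanningTreeBip H T ∧
        g = fun j => {a ∈ T | a.2 = j}.ncard} =
      {g : R → ℕ | ∃ T : Set (R × L), IsSpanningTreeBip (Prod.swap ⁻¹' H) T ∧ g = leftDeg T} := by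
    ext g
    constructor
    · rintro ⟨T, hT, rfl⟩
      exact ⟨_, hT.swap, funext fun j => (leftDeg_swap T j).symm⟩
    · rintro ⟨T, hT, rfl⟩
      refine ⟨Prod.swap ⁻¹' T, by simpa [← Set.preimage_comp] using hT.swap, funext fun j => ?_⟩
      rw [← leftDeg_swap, ← Set.preimage_comp, Prod.swap_swap_eq, Set.preimage_id]
  rw [hright, ← ncard_setOf_isLexTree _ hl', ← ncard_setOf_isLexTree_swap]
  exact (ncard_setOf_isLexTree H hl).symm
end
end

section
/- Let H be a bipartite digraph with bipartition (P,N) and arc set E(H) ⊆ P×N, and let S, T be two spanning trees of H such that deg_S(P) = deg_T(P). Then for every arc (i,j) ∈ E(T) \ E(S) there exists a cycle C in H containing the arc (i,j) such that every forward arc of C belongs to S and every backward arc of C belongs to T. -/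
noncomputable section

/-- A vertex of a connected graph other than `r` has a neighbour strictly closer to `r`. -/
theorem SimpleGraph.Connected.exists_adj_dist_lt {V : Type*} {G : SimpleGraph V}
    (hG : G.Connected) {v r : V} (h : v ≠ r) : ∃ u, G.Adj v u ∧ G.dist u r < G.dist v r := by
  obtain ⟨p, hp⟩ := hG.exists_walk_length_eq_dist v r
  cases p with
  | nil => exact absurd rfl h
  | cons hadj q =>
    refine ⟨_, hadj, ?_⟩
    have := SimpleGraph.dist_le q
    rw [SimpleGraph.Walk.length_cons] at hp
    omega

/-- If the arcs in `T` connect all vertices, then a vertex set `A` missing some vertex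
touches at least `#A` arcs. -/
theorem card_le_card_incident {V : Type*} [DecidableEq V] (T : Finset (V × V))
    (hT : (SimpleGraph.fromRel (fun u v => (u, v) ∈ T)).Connected) (A : Finset V) {r : V}
    (hr : r ∉ A) : A.card ≤ (T.filter (fun a => a.1 ∈ A ∨ a.2 ∈ A)).card := by
  set G := SimpleGraph.fromRel (fun u v => (u, v) ∈ T) with hG
  have key : ∀ v ∈ A, ∃ u, ((v, u) ∈ T ∨ (u, v) ∈ T) ∧ G.dist u r < G.dist v r := by
    intro v hv
    obtain ⟨u, hu, hlt⟩ := hT.exists_adj_dist_lt (v := v) (r := r) (by rintro rfl; exact hr hv)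
    exact ⟨u, ((SimpleGraph.fromRel_adj _ _ _).1 hu).2, hlt⟩
  choose! f hf hlt using key
  refine Finset.card_le_card_of_injOn (fun v => if (v, f v) ∈ T then (v, f v) else (f v, v))
    ?_ ?_
  · intro v hv
    have hv' : v ∈ A := hv
    have := hf v hv'
    simp only [Finset.coe_filter, Set.mem_ofPred_eq]
    split_ifs with h
    · exact ⟨h, Or.inl hv'⟩
    · exact ⟨this.resolve_left h, Or.inr hv'⟩
  · intro v hv w hw h
    have h1 := hlt v hv
    have h2 := hlt w hw
    dsimp only at h
    split_ifs at h <;> simp only [Prod.mk.injEq] at h <;> obtain ⟨h3, h4⟩ := h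
    · exact h3
    · rw [h4] at h1
      rw [← h3] at h2
      omega
    · rw [h3] at h1
      rw [← h4] at h2
      omega
    · exact h4

/-- An antisymmetric arc set whose underlying graph is a tree has one arc less than vertices. -/
theorem card_add_one_of_isTree {V : Type*} [Fintype V] (T : Finset (V × V))
    (hT : (SimpleGraph.fromRel (fun u v => (u, v) ∈ T)).IsTree)
    (hasymm : ∀ u v, (u, v) ∈ T → (v, u) ∉ T) : T.card + 1 = Fintype.card V := by
  classical
  rw [← hT.card_edgeFinset]
  congr 1
  refine Finset.card_bij (fun a _ => s(a.1, a.2)) ?_ ?_ ?_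
  · rintro ⟨u, v⟩ h
    rw [SimpleGraph.mem_edgeFinset, SimpleGraph.mem_edgeSet, SimpleGraph.fromRel_adj]
    refine ⟨fun huv => ?_, Or.inl h⟩
    have huv' : u = v := huv
    subst huv'
    exact hasymm _ _ h h
  · rintro ⟨u, v⟩ h ⟨u', v'⟩ h' heq
    rcases Sym2.eq_iff.1 heq with ⟨h1, h2⟩ | ⟨h1, h2⟩
    · exact Prod.ext h1 h2
    · dsimp only at h1 h2
      rw [← h1, ← h2] at h'
      exact absurd h' (hasymm _ _ h)
  · intro e
    induction e using Sym2.ind with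
    | _ u v =>
      intro h
      rw [SimpleGraph.mem_edgeFinset, SimpleGraph.mem_edgeSet, SimpleGraph.fromRel_adj] at h
      rcases h.2 with h | h
      · exact ⟨(u, v), h, rfl⟩
      · exact ⟨(v, u), h, Sym2.eq_swap⟩

/-- A reachable node is reachable along a path without repeated nodes. -/
theorem Relation.ReflTransGen.exists_injOn_path {V : Type*} {r : V → V → Prop} {a b : V}
    (h : Relation.ReflTransGen r a b) :
    ∃ (n : ℕ) (f : ℕ → V), f 0 = a ∧ f n = b ∧ (∀ k < n, r (f k) (f (k + 1))) ∧
      Set.InjOn f (Set.Iic n) := by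
  classical
  have hex : ∃ (n : ℕ) (f : ℕ → V), f 0 = a ∧ f n = b ∧ ∀ k < n, r (f k) (f (k + 1)) := by
    induction h with
    | refl => exact ⟨0, fun _ => a, rfl, rfl, by simp⟩
    | @tail b c _ hbc ih =>
      obtain ⟨n, f, h0, hn, hf⟩ := ih
      refine ⟨n + 1, fun k => if k ≤ n then f k else c, by simpa using h0, by simp, ?_⟩
      intro k hk
      rcases Nat.lt_succ_iff_lt_or_eq.1 hk with hk' | rfl
      · simpa [hk'.le, Nat.succ_le_of_lt hk'] using hf k hk'
      · simpa [hn] using hbc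
  obtain ⟨f, h0, hn, hf⟩ := Nat.find_spec hex
  have hmin := fun m (hm : m < Nat.find hex) => Nat.find_min hex hm
  generalize Nat.find hex = n at *
  refine ⟨n, f, h0, hn, hf, ?_⟩
  have key : ∀ p q, p < q → q ≤ n → f p ≠ f q := by
    intro p q hpq hq heq
    refine hmin (n - (q - p)) (by omega)
      ⟨fun k => if k ≤ p then f k else f (k + (q - p)), by simpa using h0, ?_, ?_⟩
    · dsimp only
      split_ifs with hc
      · have h1 : n - (q - p) = p := by omega
        have h2 : q = n := by omega
        rw [h1, heq, h2, hn]
      · rw [show n - (q - p) + (q - p) = n by omega, hn]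
    · intro k hk
      dsimp only
      rcases lt_trichotomy k p with hkp | rfl | hkp
      · rw [if_pos hkp.le, if_pos (Nat.succ_le_of_lt hkp)]
        exact hf k (by omega)
      · rw [if_pos le_rfl, if_neg (by omega), heq, show k + 1 + (q - k) = q + 1 by omega]
        exact hf q (by omega)
      · rw [if_neg (by omega), if_neg (by omega),
          show k + 1 + (q - p) = k + (q - p) + 1 by omega]
        exact hf _ (by omega)
  intro p hp q hq heq
  rcases lt_trichotomy p q with hlt | h' | hlt
  · exact absurd heq (key p q hlt hq)
  · exact h'
  · exact absurd heq.symm (key q p hlt hp)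

/-- An arc `b → a` together with a directed path from `a` to `b ≠ a` closes up to a directed
cycle without repeated nodes. -/
theorem Relation.ReflTransGen.exists_cycle {V : Type*} {r : V → V → Prop} {a b : V}
    (h : Relation.ReflTransGen r a b) (hba : r b a) (hne : a ≠ b) :
    ∃ m : ℕ, 2 ≤ m ∧ ∃ v : ZMod m → V, Function.Injective v ∧
      (∀ l, r (v l) (v (l + 1))) ∧ ∃ l, v l = b ∧ v (l + 1) = a := by
  obtain ⟨n, f, h0, hn, hf, hinj⟩ := h.exists_injOn_path
  have hn0 : n ≠ 0 := by
    rintro rfl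
    exact hne (h0.symm.trans hn)
  have hlast : ∀ l : Fin (n + 1), l.val = n → l + 1 = 0 := by
    intro l hl
    have : l = Fin.last n := Fin.ext hl
    rw [this, Fin.last_add_one]
  have hstep : ∀ l : Fin (n + 1), r (f l.val) (f (l + 1).val) := by
    intro l
    by_cases hl : l.val = n
    · rw [hlast l hl, hl, hn, Fin.val_zero, h0]
      exact hba
    · have hlt : l.val < n := by have := l.isLt; omega
      rw [Fin.val_add_one_of_lt (Fin.lt_def.2 (by simpa using hlt))]
      exact hf _ hlt
  have hclose : f (Fin.last n + 1).val = a := by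
    rw [hlast _ rfl, Fin.val_zero, h0]
  refine ⟨n + 1, by omega, fun l : Fin (n + 1) => f l.val, ?_, hstep, Fin.last n, hn, hclose⟩
  intro x y hxy
  exact Fin.ext (hinj (Nat.lt_succ_iff.1 x.isLt) (Nat.lt_succ_iff.1 y.isLt) hxy)

/-- The left degrees over a set `A` of left nodes add up to the number of arcs leaving `A`. -/
theorem sum_treeDeg {d : ℕ} {P N : Finset (Fin d)} (hPN : Disjoint P N)
    (T : Finset (Fin d × Fin d)) (hT : ∀ a ∈ T, a.1 ∈ P ∧ a.2 ∈ N) {A : Finset (Fin d)}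
    (hA : A ⊆ P) :
    ∑ p ∈ A, treeDeg d T p = (T.filter (fun a => a.1 ∈ A)).card := by
  rw [Finset.card_eq_sum_card_fiberwise (f := Prod.fst) (t := A)
    (s := T.filter (fun a => a.1 ∈ A)) (fun a ha => (Finset.mem_filter.1 ha).2)]
  refine Finset.sum_congr rfl fun p hp => ?_
  rw [treeDeg, ← Set.ncard_coe_finset]
  congr 1
  ext a
  simp only [Finset.mem_coe, Set.mem_ofPred_eq, Finset.coe_filter, Finset.mem_filter]
  constructor
  · rintro ⟨ha, h | h⟩
    · exact ⟨⟨ha, h ▸ hp⟩, h⟩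
    · exact absurd (h ▸ (hT a ha).2) (Finset.disjoint_left.1 hPN (hA hp))
  · rintro ⟨⟨ha, _⟩, h⟩
    exact ⟨ha, Or.inl h⟩

/-- If two spanning trees have the same left degrees, every node is reachable from every other
one along arcs of the first tree and reversed arcs of the second one. -/
theorem reflTransGen_of_equal_left_degrees {d : ℕ} {P N : Finset (Fin d)}
    (hPN : IsBipartition d P N) (S T : Finset (Fin d × Fin d))
    (hSPN : ∀ a ∈ S, a.1 ∈ P ∧ a.2 ∈ N) (hTPN : ∀ a ∈ T, a.1 ∈ P ∧ a.2 ∈ N)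
    (hS : (SimpleGraph.fromRel (fun u v => (u, v) ∈ S)).IsTree)
    (hT : (SimpleGraph.fromRel (fun u v => (u, v) ∈ T)).Connected)
    (hdeg : ∀ i ∈ P, treeDeg d S i = treeDeg d T i) (i j : Fin d) :
    Relation.ReflTransGen (fun u v => (u, v) ∈ S ∨ (v, u) ∈ T) i j := by
  obtain ⟨-, -, hdisj, -⟩ := hPN
  by_contra hij
  classical
  set R : Finset (Fin d) := Finset.univ.filter
    (fun u => Relation.ReflTransGen (fun u v => (u, v) ∈ S ∨ (v, u) ∈ T) i u) with hR
  have memR : ∀ u, u ∈ R ↔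
      Relation.ReflTransGen (fun u v => (u, v) ∈ S ∨ (v, u) ∈ T) i u := by simp [hR]
  have hclosed : ∀ u ∈ R, ∀ v, ((u, v) ∈ S ∨ (v, u) ∈ T) → v ∈ R := fun u hu v huv =>
    (memR v).2 (((memR u).1 hu).tail huv)
  have hiR : i ∈ R := (memR i).2 .refl
  have hjR : j ∉ R := fun h => hij ((memR j).1 h)
  have hTle : R.card ≤ (T.filter (fun a => a.1 ∈ R ∩ P)).card := by
    refine (card_le_card_incident T hT R hjR).trans (Finset.card_le_card ?_)
    intro a ha
    rw [Finset.mem_filter] at ha ⊢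
    refine ⟨ha.1, Finset.mem_inter.2 ⟨?_, (hTPN a ha.1).1⟩⟩
    exact ha.2.elim id fun h => hclosed _ h _ (Or.inr ha.1)
  have hScompl := card_le_card_incident S hS.1 Rᶜ (r := i) (by simpa using hiR)
  have hScard := card_add_one_of_isTree S hS fun u v h h' =>
    Finset.disjoint_left.1 hdisj (hSPN _ h).1 (hSPN _ h').2
  have hSsplit : (S.filter (fun a => a.1 ∈ R ∩ P)).card +
      (S.filter (fun a => a.1 ∈ Rᶜ ∨ a.2 ∈ Rᶜ)).card ≤ S.card := by
    rw [← Finset.card_union_of_disjoint]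
    · exact Finset.card_le_card
        (Finset.union_subset (Finset.filter_subset _ _) (Finset.filter_subset _ _))
    · refine Finset.disjoint_left.2 fun a ha ha' => ?_
      rw [Finset.mem_filter] at ha ha'
      have h1 : a.1 ∈ R := (Finset.mem_inter.1 ha.2).1
      have h2 : a.2 ∈ R := hclosed _ h1 _ (Or.inl ha.1)
      simp [h1, h2] at ha'
  have hsum : (S.filter (fun a => a.1 ∈ R ∩ P)).card =
      (T.filter (fun a => a.1 ∈ R ∩ P)).card := by
    rw [← sum_treeDeg hdisj S hSPN Finset.inter_subset_right,
      ← sum_treeDeg hdisj T hTPN Finset.inter_subset_right]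
    exact Finset.sum_congr rfl fun p hp => hdeg p (Finset.mem_inter.1 hp).2
  have hRcard := Finset.card_add_card_compl R
  omega

/-- Lemma 5: if `S, T` are spanning trees of a bipartite digraph `H` (all arcs
directed from `P` to `N`) with the same left degree sequence, then every arc
`(i,j) ∈ E(T) \ E(S)` lies on an alternating cycle of `H` whose forward arcs all
belong to `S` and whose backward arcs all belong to `T`.  The cycle is encoded by
an injective cyclic sequence of nodes `v : ZMod m → Fin d` (`m ≥ 2` arcs). -/
theorem alternating_cycle_of_equal_left_degrees (d : ℕ) (hd : 2 ≤ d)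
    (P N : Finset (Fin d)) (hPN : IsBipartition d P N)
    (H : Set (Fin d × Fin d)) (hH : ∀ a ∈ H, a.1 ∈ P ∧ a.2 ∈ N)
    (S T : Set (Fin d × Fin d))
    (hS : IsSpanningTreeOf d H S) (hT : IsSpanningTreeOf d H T)
    (hdeg : ∀ i ∈ P, treeDeg d S i = treeDeg d T i)
    (i j : Fin d) (hij : (i, j) ∈ T) (hij' : (i, j) ∉ S) :
    ∃ m : ℕ, 2 ≤ m ∧ ∃ v : ZMod m → Fin d, Function.Injective v ∧
      (∀ l : ZMod m, (v l, v (l + 1)) ∈ S ∨ (v (l + 1), v l) ∈ T) ∧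
      (∃ l : ZMod m, (v l, v (l + 1)) = (i, j) ∨ (v (l + 1), v l) = (i, j)) := by
  classical
  have hSH : ∀ a ∈ S.toFinset, a.1 ∈ P ∧ a.2 ∈ N := fun a ha => hH a (hS.1 (Set.mem_toFinset.1 ha))
  have hTH : ∀ a ∈ T.toFinset, a.1 ∈ P ∧ a.2 ∈ N := fun a ha => hH a (hT.1 (Set.mem_toFinset.1 ha))
  have hreach := reflTransGen_of_equal_left_degrees hPN S.toFinset T.toFinset hSH hTH
    (by simpa only [Set.mem_toFinset] using hS.2)
    (by simpa only [Set.mem_toFinset] using hT.2.1)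
    (by simpa only [Set.coe_toFinset] using hdeg) i j
  simp only [Set.mem_toFinset] at hreach
  have hne : i ≠ j := by
    rintro rfl
    have := hH _ (hT.1 hij)
    exact Finset.disjoint_left.1 hPN.2.2.1 this.1 this.2
  obtain ⟨m, hm, v, hinj, hv, l, hl, hl'⟩ := hreach.exists_cycle (Or.inr hij) hne
  exact ⟨m, hm, v, hinj, hv, l, Or.inr (Prod.ext hl' hl)⟩
end
end

section
/- Let x and y be two feasible tree solutions with respect to a bipartition (P,N) such that x ≠ αy for all α > 0. Then 𝒫(x) ∩ 𝒫(y) = ∅ and 𝒩(x) ∩ 𝒩(y) = ∅; that is, no left degree sequence of a spanning tree of H(x) is a left degree sequence of a spanning tree of H(y), and the same for right degree sequences. -/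
noncomputable section

/-- The subgraph `H(y)` of `G(P,N)`: the arcs `(i,j) ∈ P × N` along which the
inequality `π i j * y i ≥ y j` holds with equality. -/
def Hgraph (d : ℕ) (π : Fin d → Fin d → ℝ) (P N : Finset (Fin d)) (y : Fin d → ℝ) :
    Set (Fin d × Fin d) :=
  {a | a.1 ∈ P ∧ a.2 ∈ N ∧ π a.1 a.2 * y a.1 = y a.2}

/-- `𝒫(y)`: the left degree sequences of spanning trees of `H(y)`. -/
def Pfam (d : ℕ) (π : Fin d → Fin d → ℝ) (P N : Finset (Fin d)) (y : Fin d → ℝ) :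
    Set ({i // i ∈ P} → ℕ) :=
  {c | ∃ T : Set (Fin d × Fin d), IsSpanningTreeOf d (Hgraph d π P N y) T ∧
    c = fun i => treeDeg d T i.1}

/-- `𝒩(y)`: the right degree sequences of spanning trees of `H(y)`. -/
def Nfam (d : ℕ) (π : Fin d → Fin d → ℝ) (P N : Finset (Fin d)) (y : Fin d → ℝ) :
    Set ({j // j ∈ N} → ℕ) :=
  {b | ∃ T : Set (Fin d × Fin d), IsSpanningTreeOf d (Hgraph d π P N y) T ∧
    b = fun j => treeDeg d T j.1}

section BipartiteTrees

open SimpleGraph Finset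

variable {V : Type*}

theorem SimpleGraph.IsAcyclic.card_edgeFinset_lt [Fintype V] [Nonempty V] {G : SimpleGraph V}
    [Fintype G.edgeSet] (hG : G.IsAcyclic) : #G.edgeFinset < Fintype.card V := by
  classical
  obtain ⟨H, hGH, hH⟩ := exists_maximal_isAcyclic_of_le_isAcyclic (G := ⊤) le_top hG
  have hT : H.IsTree := (connected_top.maximal_le_isAcyclic_iff_isTree le_top).1 hH
  have hle : #G.edgeFinset ≤ #H.edgeFinset := card_le_card (edgeFinset_mono hGH)
  have := hT.card_edgeFinset
  lia

/-- In a bipartite forest, the degree sum over a set of vertices of one part which lie in `S`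
together with all their neighbors is less than `#S`. -/
theorem SimpleGraph.IsAcyclic.sum_degree_lt_card [Fintype V] [DecidableEq V] {G : SimpleGraph V}
    [DecidableRel G.Adj] (hG : G.IsAcyclic) {Q S : Finset V}
    (hQ : G.IsBipartiteWith (Q : Set V) (Q : Set V)ᶜ) (hS : S.Nonempty)
    (hclosed : ∀ q ∈ Q, q ∈ S → ∀ v, G.Adj q v → v ∈ S) :
    ∑ q ∈ Q with q ∈ S, G.degree q < #S := by
  have : Nonempty (S : Set V) := hS.to_subtype
  have hbip : (G.induce (S : Set V)).IsBipartiteWith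
      ((Q.subtype (· ∈ (S : Set V)) : Finset (S : Set V)) : Set (S : Set V))
      ((Qᶜ.subtype (· ∈ (S : Set V)) : Finset (S : Set V)) : Set (S : Set V)) := by
    refine ⟨?_, fun v w hvw => ?_⟩
    · rw [Set.disjoint_left]
      simp +contextual
    · simpa using hQ.mem_of_adj hvw
  have hdeg : ∀ q ∈ Q.subtype (· ∈ (S : Set V)),
      (G.induce (S : Set V)).degree q = G.degree (q : V) := fun q hq => by
    convert degree_induce_of_neighborSet_subset (G := G) (v := q) fun v hv =>
      hclosed q (by simpa using hq) q.2 v hv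
  have hlt := (hG.induce (S : Set V)).card_edgeFinset_lt
  rw [← isBipartiteWith_sum_degrees_eq_card_edges hbip] at hlt
  rw [sum_congr rfl hdeg] at hlt
  rw [sum_subtype_eq_sum_filter (fun q => G.degree q)] at hlt
  simpa using hlt

/-- Two bipartite spanning trees with the same degree sequence on the part `Q` admit no proper
separation of `Q` by a set closed, on either side, under neighbors in one of the trees. -/
theorem SimpleGraph.IsTree.forall_mem_of_closed [Fintype V] {G₁ G₂ : SimpleGraph V}
    [DecidableRel G₁.Adj] [DecidableRel G₂.Adj] (hG₁ : G₁.IsTree) (hG₂ : G₂.IsTree)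
    {Q S : Finset V} (hQ₁ : G₁.IsBipartiteWith (Q : Set V) (Q : Set V)ᶜ)
    (hQ₂ : G₂.IsBipartiteWith (Q : Set V) (Q : Set V)ᶜ)
    (hdeg : ∀ q ∈ Q, G₁.degree q = G₂.degree q)
    (h₁ : ∀ q ∈ Q, q ∈ S → ∀ v, G₁.Adj q v → v ∈ S)
    (h₂ : ∀ q ∈ Q, q ∉ S → ∀ v, G₂.Adj q v → v ∉ S) (hS : S.Nonempty) :
    ∀ q ∈ Q, q ∈ S := by
  classical
  by_contra! ⟨q, hq, hqS⟩
  have hlt₁ := hG₁.isAcyclic.sum_degree_lt_card hQ₁ hS h₁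
  have hlt₂ := hG₂.isAcyclic.sum_degree_lt_card hQ₂ (S := Sᶜ) ⟨q, by simpa using hqS⟩
    (by simpa using h₂)
  have hQ₂' : G₂.IsBipartiteWith (Q : Set V) (Qᶜ : Finset V) := by simpa using hQ₂
  have hsum := isBipartiteWith_sum_degrees_eq_card_edges hQ₂'
  have hcard := hG₂.card_edgeFinset
  rw [← sum_filter_add_sum_filter_not Q (· ∈ S)] at hsum
  rw [sum_congr rfl fun q hq => hdeg q (mem_filter.1 hq).1] at hlt₁
  simp only [mem_compl] at hlt₂
  have := S.card_add_card_compl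
  lia

/-- A function which grows along the edges leaving `Q` in one bipartite spanning tree and decreases
along those in another one is constant when the trees have equal degrees on `Q`. -/
theorem SimpleGraph.IsTree.exists_eq_const [Fintype V] {G₁ G₂ : SimpleGraph V}
    [DecidableRel G₁.Adj] [DecidableRel G₂.Adj] (hG₁ : G₁.IsTree) (hG₂ : G₂.IsTree)
    {Q : Finset V} (hQ₁ : G₁.IsBipartiteWith (Q : Set V) (Q : Set V)ᶜ)
    (hQ₂ : G₂.IsBipartiteWith (Q : Set V) (Q : Set V)ᶜ)
    (hdeg : ∀ q ∈ Q, G₁.degree q = G₂.degree q) (hne : Q.Nonempty)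
    {α : Type*} [LinearOrder α] (r : V → α)
    (h₁ : ∀ q ∈ Q, ∀ v, G₁.Adj q v → r q ≤ r v)
    (h₂ : ∀ q ∈ Q, ∀ v, G₂.Adj q v → r v ≤ r q) :
    ∃ q ∈ Q, ∀ v, r v = r q := by
  classical
  obtain ⟨p, hp, hmax⟩ := Q.exists_max_image r hne
  have hmem := hG₁.forall_mem_of_closed hG₂ (S := univ.filter (r p ≤ r ·)) hQ₁ hQ₂ hdeg
    (fun q hq hqS v hv => by simpa using (by simpa using hqS : r p ≤ r q).trans (h₁ q hq v hv))
    (fun q hq hqS v hv => by simpa using (h₂ q hq v hv).trans_lt (by simpa using hqS))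
    ⟨p, by simp⟩
  have hconst : ∀ q ∈ Q, r q = r p := fun q hq =>
    le_antisymm (hmax q hq) (by simpa using hmem q hq)
  refine ⟨p, hp, fun v => ?_⟩
  by_cases hv : v ∈ Q
  · exact hconst v hv
  have : Nontrivial V := ⟨p, v, fun h => hv (h ▸ hp)⟩
  have hnbr : ∀ G : SimpleGraph V, G.IsTree → G.IsBipartiteWith (Q : Set V) (Q : Set V)ᶜ →
      ∃ q ∈ Q, G.Adj q v := fun G hG hQ => by
    obtain ⟨w, hw⟩ := hG.connected.preconnected.exists_adj_of_nontrivial v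
    refine ⟨w, ?_, hw.symm⟩
    simpa [hv] using hQ.mem_of_adj hw
  obtain ⟨q₁, hq₁, ha₁⟩ := hnbr G₁ hG₁ hQ₁
  obtain ⟨q₂, hq₂, ha₂⟩ := hnbr G₂ hG₂ hQ₂
  exact le_antisymm (hconst q₂ hq₂ ▸ h₂ q₂ hq₂ v ha₂) (hconst q₁ hq₁ ▸ h₁ q₁ hq₁ v ha₁)

end BipartiteTrees

section TreeSolutions

variable {d : ℕ} {π : Fin d → Fin d → ℝ} {P N : Finset (Fin d)} {T : Set (Fin d × Fin d)}

theorem IsBipartition.mem_right_iff (h : IsBipartition d P N) {v : Fin d} : v ∈ N ↔ v ∉ P := by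
  have hv : v ∈ P ∪ N := h.2.2.2 ▸ Finset.mem_univ v
  have : v ∈ P → v ∉ N := fun hP => Finset.disjoint_left.1 h.2.2.1 hP
  rw [Finset.mem_union] at hv
  tauto

theorem isBipartiteWith_fromRel (h : IsBipartition d P N) (hT : T ⊆ {a | a.1 ∈ P ∧ a.2 ∈ N}) :
    (SimpleGraph.fromRel fun u v => (u, v) ∈ T).IsBipartiteWith (P : Set (Fin d))
      (P : Set (Fin d))ᶜ := by
  refine ⟨disjoint_compl_right, fun v w hvw => ?_⟩
  rcases hvw.2 with hvw | hvw
  · exact Or.inl ⟨(hT hvw).1, h.mem_right_iff.1 (hT hvw).2⟩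
  · exact Or.inr ⟨h.mem_right_iff.1 (hT hvw).2, (hT hvw).1⟩

theorem treeDeg_eq_degree (h : IsBipartition d P N) (hT : T ⊆ {a | a.1 ∈ P ∧ a.2 ∈ N})
    [DecidableRel (SimpleGraph.fromRel fun u v => (u, v) ∈ T).Adj] (i : Fin d) :
    treeDeg d T i = (SimpleGraph.fromRel fun u v => (u, v) ∈ T).degree i := by
  have hne : ∀ u v, (u, v) ∈ T → u ≠ v := fun u v huv e =>
    h.mem_right_iff.1 (hT huv).2 (e ▸ (hT huv).1)
  rw [← SimpleGraph.card_neighborFinset_eq_degree, ← Set.ncard_coe_finset, treeDeg]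
  refine Set.ncard_congr (fun a _ => if a.1 = i then a.2 else a.1) ?_ ?_ ?_
  · rintro ⟨u, v⟩ ⟨huv, ha⟩
    have := hne u v huv
    by_cases hu : u = i
    · subst hu
      simpa [huv] using this
    · obtain rfl : v = i := by simpa [hu] using ha
      simpa [hu, huv] using this.symm
  · rintro ⟨u, v⟩ ⟨u', v'⟩ ⟨huv, ha⟩ ⟨huv', ha'⟩ heq
    have hu := (hT huv).1
    have hv := h.mem_right_iff.1 (hT huv).2
    have hu' := (hT huv').1
    have hv' := h.mem_right_iff.1 (hT huv').2
    grind
  · intro b hb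
    rw [SimpleGraph.coe_neighborFinset, SimpleGraph.mem_neighborSet,
      SimpleGraph.fromRel_adj] at hb
    obtain ⟨hib, hb | hb⟩ := hb
    · exact ⟨(i, b), ⟨hb, Or.inl rfl⟩, by simp⟩
    · exact ⟨(b, i), ⟨hb, Or.inr rfl⟩, by simp [hib.symm]⟩

theorem Feasible.pos {y : Fin d → ℝ} (hy : Feasible d π P N y) (h : IsBipartition d P N)
    (hπ : ∀ i j, 0 < π i j) (v : Fin d) : 0 < y v := by
  obtain ⟨⟨i, hi⟩, ⟨j, hj⟩, -, -⟩ := id h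
  by_cases hv : v ∈ P
  · exact pos_of_mul_pos_right ((hy v hv j hj).2.trans_le (hy v hv j hj).1) (hπ v j).le
  · exact (hy i hi v (h.mem_right_iff.2 hv)).2

/-- Along an arc of `H(x)`, the ratio `x / y` of feasible vectors does not decrease. -/
theorem Feasible.div_le_div_of_mem_Hgraph {x y : Fin d → ℝ} (hy : Feasible d π P N y)
    (hpos : ∀ v, 0 < y v) (hx : ∀ v, 0 < x v) {i j : Fin d} (ha : (i, j) ∈ Hgraph d π P N x) :
    x i / y i ≤ x j / y j := by
  obtain ⟨hi, hj, ha⟩ := ha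
  rw [div_le_div_iff₀ (hpos i) (hpos j)]
  calc x i * y j ≤ x i * (π i j * y i) := mul_le_mul_of_nonneg_left (hy i hi j hj).1 (hx i).le
    _ = π i j * x i * y i := by ring
    _ = x j * y i := by rw [ha]

theorem Feasible.div_le_div_of_mem_Hgraph' {x y : Fin d → ℝ} (hx : Feasible d π P N x)
    (hxpos : ∀ v, 0 < x v) (hpos : ∀ v, 0 < y v) {i j : Fin d}
    (ha : (i, j) ∈ Hgraph d π P N y) : x j / y j ≤ x i / y i := by
  simpa using inv_anti₀ (div_pos (hpos i) (hxpos i)) (hx.div_le_div_of_mem_Hgraph hxpos hpos ha)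

end TreeSolutions

/-- Lemma 6: if `x` and `y` are feasible tree solutions with respect to the same
bipartition `(P,N)` and are not positive multiples of each other, then
`𝒫(x) ∩ 𝒫(y) = ∅` and `𝒩(x) ∩ 𝒩(y) = ∅`. -/
theorem Pfam_disjoint_and_Nfam_disjoint (d : ℕ) (hd : 2 ≤ d) (π : Fin d → Fin d → ℝ)
    (h1 : ∀ i, π i i = 1)
    (h2 : ∀ i j, 0 < π i j)
    (h3 : ∀ i j k, π i j ≤ π i k * π k j)
    (h4 : ∃ i j k, π i j < π i k * π k j)
    (P N : Finset (Fin d)) (hPN : IsBipartition d P N)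
    (x y : Fin d → ℝ)
    (hx : IsFeasibleTreeSolution d π P N x)
    (hy : IsFeasibleTreeSolution d π P N y)
    (hxy : ∀ α : ℝ, 0 < α → x ≠ α • y) :
    Pfam d π P N x ∩ Pfam d π P N y = ∅ ∧ Nfam d π P N x ∩ Nfam d π P N y = ∅ := by
  classical
  obtain ⟨-, -, -, hxF⟩ := hx
  obtain ⟨-, -, -, hyF⟩ := hy
  have hxpos := hxF.pos hPN h2
  have hypos := hyF.pos hPN h2
  have hratio : ¬∃ q : Fin d, ∀ v, x v / y v = x q / y q := fun ⟨q, hq⟩ =>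
    hxy _ (div_pos (hxpos q) (hypos q)) <| funext fun v => by
      simpa using (div_eq_iff (hypos v).ne').1 (hq v)
  have hN : (N : Set (Fin d)) = (P : Set (Fin d))ᶜ := by
    ext v
    exact hPN.mem_right_iff
  have hsub : ∀ z T, T ⊆ Hgraph d π P N z → T ⊆ {a | a.1 ∈ P ∧ a.2 ∈ N} := fun z T hT a ha =>
    ⟨(hT ha).1, (hT ha).2.1⟩
  have hleft : ∀ z T, T ⊆ Hgraph d π P N z → ∀ q ∈ P, ∀ v,
      (SimpleGraph.fromRel fun u v => (u, v) ∈ T).Adj q v → (q, v) ∈ Hgraph d π P N z := by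
    rintro z T hT q hq v ⟨-, h | h⟩
    · exact hT h
    · exact absurd hq (hPN.mem_right_iff.1 (hT h).2.1)
  have hright : ∀ z T, T ⊆ Hgraph d π P N z → ∀ q ∈ N, ∀ v,
      (SimpleGraph.fromRel fun u v => (u, v) ∈ T).Adj q v → (v, q) ∈ Hgraph d π P N z := by
    rintro z T hT q hq v ⟨-, h | h⟩
    · exact absurd (hT h).1 (hPN.mem_right_iff.1 hq)
    · exact hT h
  refine ⟨Set.eq_empty_of_forall_notMem ?_, Set.eq_empty_of_forall_notMem ?_⟩
  · rintro c ⟨⟨T, ⟨hTx, hT⟩, hc⟩, T', ⟨hTy, hT'⟩, hc'⟩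
    have hdeg := hc.symm.trans hc'
    obtain ⟨q, -, hq⟩ := hT.exists_eq_const hT' (Q := P)
      (isBipartiteWith_fromRel hPN (hsub x T hTx)) (isBipartiteWith_fromRel hPN (hsub y T' hTy))
      (fun q hq => by
        rw [← treeDeg_eq_degree hPN (hsub x T hTx), ← treeDeg_eq_degree hPN (hsub y T' hTy)]
        exact congrFun hdeg ⟨q, hq⟩) hPN.1 (fun v => x v / y v)
      (fun q hq v hv => hyF.div_le_div_of_mem_Hgraph hypos hxpos (hleft x T hTx q hq v hv))
      (fun q hq v hv => hxF.div_le_div_of_mem_Hgraph' hxpos hypos (hleft y T' hTy q hq v hv))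
    exact hratio ⟨q, hq⟩
  · rintro c ⟨⟨T, ⟨hTx, hT⟩, hc⟩, T', ⟨hTy, hT'⟩, hc'⟩
    have hdeg := hc.symm.trans hc'
    obtain ⟨q, -, hq⟩ := hT'.exists_eq_const hT (Q := N)
      (by simpa [hN] using (isBipartiteWith_fromRel hPN (hsub y T' hTy)).symm)
      (by simpa [hN] using (isBipartiteWith_fromRel hPN (hsub x T hTx)).symm)
      (fun q hq => by
        rw [← treeDeg_eq_degree hPN (hsub x T hTx), ← treeDeg_eq_degree hPN (hsub y T' hTy)]
        exact (congrFun hdeg ⟨q, hq⟩).symm) hPN.2.1 (fun v => x v / y v)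
      (fun q hq v hv => hxF.div_le_div_of_mem_Hgraph' hxpos hypos (hright y T' hTy q hq v hv))
      (fun q hq v hv => hyF.div_le_div_of_mem_Hgraph hypos hxpos (hright x T hTx q hq v hv))
    exact hratio ⟨q, hq⟩
end
end

section
/- For every bipartition (P,N) of V and every P-configuration c ∈ ℕ^P there exists a feasible tree solution y ∈ ℝ^d generated by a spanning tree T of G(P,N) with deg_T(P) = c. Analogously, for every N-configuration b ∈ ℕ^N there exists a feasible tree solution generated by a spanning tree T with deg_T(N) = b. -/
noncomputable section

/-- The set of heads of arcs of `E` whose tail lies in `A`. -/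
def outNeighbors {V : Type*} [DecidableEq V] (E : Finset (V × V)) (A : Finset V) : Finset V :=
  (E.filter (fun e => e.1 ∈ A)).image Prod.snd

/-- Every nonempty `A ⊆ P` has more than `∑ i ∈ A, a i` out-neighbours in `E`. -/
def IsDraconian {V : Type*} [DecidableEq V] (P : Finset V) (a : V → ℕ)
    (E : Finset (V × V)) : Prop :=
  ∀ A ⊆ P, A.Nonempty → ∑ i ∈ A, a i + 1 ≤ (outNeighbors E A).card

section Combinatorics

variable {V : Type*} [DecidableEq V]

theorem mem_outNeighbors {E : Finset (V × V)} {A : Finset V} {j : V} :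
    j ∈ outNeighbors E A ↔ ∃ i ∈ A, (i, j) ∈ E := by
  simp only [outNeighbors, Finset.mem_image, Finset.mem_filter, Prod.exists]
  constructor
  · rintro ⟨i, k, ⟨h, hi⟩, rfl⟩
    exact ⟨i, hi, h⟩
  · rintro ⟨i, hi, h⟩
    exact ⟨i, j, ⟨h, hi⟩, rfl⟩

theorem outNeighbors_mono {E : Finset (V × V)} {A B : Finset V} (h : A ⊆ B) :
    outNeighbors E A ⊆ outNeighbors E B := by
  intro j hj
  obtain ⟨i, hi, hij⟩ := mem_outNeighbors.1 hj
  exact mem_outNeighbors.2 ⟨i, h hi, hij⟩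

theorem outNeighbors_union (E : Finset (V × V)) (A B : Finset V) :
    outNeighbors E (A ∪ B) = outNeighbors E A ∪ outNeighbors E B := by
  ext j
  simp only [mem_outNeighbors, Finset.mem_union]
  grind

/-- Tight sets of a Draconian arc set with a common element are closed under intersection. -/
theorem IsDraconian.inter_tight {P : Finset V} {a : V → ℕ} {E : Finset (V × V)}
    (hE : IsDraconian P a E) {A B : Finset V} (hA : A ⊆ P) (hB : B ⊆ P)
    (hAB : (A ∩ B).Nonempty)
    (tA : (outNeighbors E A).card = ∑ i ∈ A, a i + 1)
    (tB : (outNeighbors E B).card = ∑ i ∈ B, a i + 1) :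
    (outNeighbors E (A ∩ B)).card = ∑ i ∈ A ∩ B, a i + 1 := by
  have hU := hE (A ∪ B) (Finset.union_subset hA hB) (hAB.mono (by grind))
  have hI := hE (A ∩ B) (Finset.inter_subset_left.trans hA) hAB
  have hs := Finset.sum_union_inter (s₁ := A) (s₂ := B) (f := a)
  have hc := Finset.card_union_add_card_inter (outNeighbors E A) (outNeighbors E B)
  rw [outNeighbors_union] at hU
  have hle : (outNeighbors E (A ∩ B)).card ≤ (outNeighbors E A ∩ outNeighbors E B).card :=
    Finset.card_le_card (Finset.subset_inter (outNeighbors_mono Finset.inter_subset_left)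
      (outNeighbors_mono Finset.inter_subset_right))
  omega

/-- Each arc of a minimal Draconian arc set is critical for some tight set. -/
theorem exists_tight_of_minimal {P : Finset V} {a : V → ℕ} {E : Finset (V × V)}
    (hE : Minimal (IsDraconian P a) E) {i j : V} (hij : (i, j) ∈ E) :
    ∃ A ⊆ P, i ∈ A ∧ (outNeighbors E A).card = ∑ k ∈ A, a k + 1 ∧
      j ∉ outNeighbors E (A.erase i) := by
  have hnot : ¬ IsDraconian P a (E.erase (i, j)) := fun h =>
    (Finset.notMem_erase (i, j) E) (hE.2 h (Finset.erase_subset _ _) hij)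
  simp only [IsDraconian, not_forall, not_le] at hnot
  obtain ⟨A, hAP, hne, hlt⟩ := hnot
  have hge := hE.1 A hAP hne
  have hsub : outNeighbors E A ⊆ insert j (outNeighbors (E.erase (i, j)) A) := by
    intro k hk
    obtain ⟨l, hl, hlk⟩ := mem_outNeighbors.1 hk
    simp only [Finset.mem_insert, mem_outNeighbors, Finset.mem_erase]
    grind
  have hneq : ¬ outNeighbors E A ⊆ outNeighbors (E.erase (i, j)) A := fun h => by
    have := Finset.card_le_card h
    omega
  have hcard := Finset.card_le_card hsub
  have hins := Finset.card_insert_le j (outNeighbors (E.erase (i, j)) A)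
  refine ⟨A, hAP, ?_, by omega, ?_⟩
  · by_contra hi
    refine hneq fun k hk => ?_
    obtain ⟨l, hl, hlk⟩ := mem_outNeighbors.1 hk
    exact mem_outNeighbors.2 ⟨l, hl, Finset.mem_erase.2 ⟨by grind, hlk⟩⟩
  · intro hj
    obtain ⟨l, hl, hlj⟩ := mem_outNeighbors.1 hj
    refine hneq (hsub.trans (Finset.insert_subset ?_ subset_rfl))
    exact mem_outNeighbors.2 ⟨l, Finset.mem_of_mem_erase hl,
      Finset.mem_erase.2 ⟨by grind, hlj⟩⟩

theorem card_outNeighbors_singleton_of_minimal {P : Finset V} {a : V → ℕ}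
    {E : Finset (V × V)} (hE : Minimal (IsDraconian P a) E) {i : V} (hi : i ∈ P) :
    (outNeighbors E {i}).card = a i + 1 := by
  have hsing := hE.1 {i} (by simpa using hi) (by simp)
  rw [Finset.sum_singleton] at hsing
  obtain ⟨j₀, hj₀⟩ := Finset.card_pos.1 (show 0 < (outNeighbors E {i}).card by omega)
  have hij₀ : (i, j₀) ∈ E := by simpa [mem_outNeighbors] using hj₀
  obtain ⟨A₀, hA₀P, hiA₀, tA₀, -⟩ := exists_tight_of_minimal hE hij₀
  obtain ⟨A, -, ⟨⟨hAP, hiA, tA⟩, hmin⟩⟩ := exists_minimal_le_of_wellFoundedLT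
    (fun A : Finset V => A ⊆ P ∧ i ∈ A ∧ (outNeighbors E A).card = ∑ k ∈ A, a k + 1) A₀
    ⟨hA₀P, hiA₀, tA₀⟩
  have hdisj : Disjoint (outNeighbors E {i}) (outNeighbors E (A.erase i)) := by
    rw [Finset.disjoint_left]
    intro j hj
    have hij : (i, j) ∈ E := by simpa [mem_outNeighbors] using hj
    obtain ⟨B, hBP, hiB, tB, hjB⟩ := exists_tight_of_minimal hE hij
    have hAB : A ⊆ A ∩ B := hmin
      ⟨Finset.inter_subset_left.trans hAP, Finset.mem_inter.2 ⟨hiA, hiB⟩,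
        hE.1.inter_tight hAP hBP ⟨i, Finset.mem_inter.2 ⟨hiA, hiB⟩⟩ tA tB⟩
      Finset.inter_subset_left
    exact fun h => hjB (outNeighbors_mono
      (Finset.erase_subset_erase i (hAB.trans Finset.inter_subset_right)) h)
  have hunion : outNeighbors E A = outNeighbors E {i} ∪ outNeighbors E (A.erase i) := by
    rw [← outNeighbors_union, ← Finset.insert_eq, Finset.insert_erase hiA]
  have hsum := Finset.add_sum_erase A a hiA
  rw [hunion, Finset.card_union_of_disjoint hdisj] at tA
  rcases (A.erase i).eq_empty_or_nonempty with h0 | h0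
  · rw [h0] at hsum
    simp only [Finset.sum_empty] at hsum
    omega
  · have := hE.1 _ ((Finset.erase_subset i A).trans hAP) h0
    omega

theorem card_filter_fst_eq (E : Finset (V × V)) (i : V) :
    (E.filter (fun e => e.1 = i)).card = (outNeighbors E {i}).card := by
  simp only [outNeighbors, Finset.mem_singleton]
  refine (Finset.card_image_of_injOn ?_).symm
  rintro ⟨x, y⟩ hx ⟨x', y'⟩ hx' h
  simp only [Finset.coe_filter, Set.mem_ofPred_eq] at hx hx' h
  grind

theorem IsDraconian.connected {P N : Finset V} {a : V → ℕ} {E : Finset (V × V)}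
    (hE : IsDraconian P a E) (hEPN : E ⊆ P ×ˢ N) (hP : P.Nonempty) (hdisj : Disjoint P N)
    (hcov : ∀ v, v ∈ P ∨ v ∈ N) (hsum : ∑ i ∈ P, a i + 1 = N.card) :
    (SimpleGraph.fromRel (fun u v => (u, v) ∈ E)).Connected := by
  classical
  set G := SimpleGraph.fromRel (fun u v => (u, v) ∈ E) with hG
  have hadj : ∀ {i j}, (i, j) ∈ E → G.Adj i j := by
    intro i j hij
    rw [hG, SimpleGraph.fromRel_adj]
    have := Finset.mem_product.1 (hEPN hij)
    exact ⟨fun h => Finset.disjoint_left.1 hdisj this.1 (by simpa [h] using this.2), .inl hij⟩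
  have hsubN : ∀ A, outNeighbors E A ⊆ N := by
    intro A j hj
    obtain ⟨i, -, hij⟩ := mem_outNeighbors.1 hj
    exact (Finset.mem_product.1 (hEPN hij)).2
  obtain ⟨i₀, hi₀⟩ := hP
  have hreachP : ∀ i ∈ P, G.Reachable i₀ i := by
    by_contra! hcon
    obtain ⟨i₁, hi₁, hn⟩ := hcon
    set A := P.filter (fun i => G.Reachable i₀ i) with hA
    set B := P.filter (fun i => ¬ G.Reachable i₀ i) with hB
    have h1 := hE A (Finset.filter_subset _ _) ⟨i₀, by simp [hA, hi₀]⟩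
    have h2 := hE B (Finset.filter_subset _ _) ⟨i₁, by simp [hB, hi₁, hn]⟩
    have hd : Disjoint (outNeighbors E A) (outNeighbors E B) := by
      rw [Finset.disjoint_left]
      intro j hj hj'
      obtain ⟨i, hi, hij⟩ := mem_outNeighbors.1 hj
      obtain ⟨k, hk, hkj⟩ := mem_outNeighbors.1 hj'
      exact (Finset.mem_filter.1 hk).2 (((Finset.mem_filter.1 hi).2.trans
        (hadj hij).reachable).trans (hadj hkj).symm.reachable)
    have h3 := Finset.card_le_card (Finset.union_subset (hsubN A) (hsubN B))
    rw [Finset.card_union_of_disjoint hd] at h3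
    have h4 : ∑ i ∈ A, a i + ∑ i ∈ B, a i = ∑ i ∈ P, a i :=
      Finset.sum_filter_add_sum_filter_not P (fun i => G.Reachable i₀ i) a
    omega
  have hreach : ∀ v, G.Reachable i₀ v := by
    intro v
    rcases hcov v with hv | hv
    · exact hreachP v hv
    · have hfull : outNeighbors E P = N := Finset.eq_of_subset_of_card_le (hsubN P)
        (hsum ▸ hE P subset_rfl ⟨i₀, hi₀⟩)
      obtain ⟨i, hi, hiv⟩ := mem_outNeighbors.1 (hfull.symm ▸ hv)
      exact (hreachP i hi).trans (hadj hiv).reachable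
  have : Nonempty V := ⟨i₀⟩
  exact ⟨fun u v => (hreach u).symm.trans (hreach v)⟩

/-- A bipartite arc set whose neighbourhoods are large enough contains a spanning tree with
prescribed degrees on one side. -/
theorem IsDraconian.exists_isTree [Fintype V] {P N : Finset V} {a : V → ℕ}
    {E : Finset (V × V)} (hE : IsDraconian P a E) (hEPN : E ⊆ P ×ˢ N) (hP : P.Nonempty)
    (hdisj : Disjoint P N) (hPN : P ∪ N = Finset.univ) (hsum : ∑ i ∈ P, a i + 1 = N.card) :
    ∃ T ⊆ E, (SimpleGraph.fromRel (fun u v => (u, v) ∈ T)).IsTree ∧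
      ∀ i ∈ P, (T.filter (fun e => e.1 = i)).card = a i + 1 := by
  classical
  obtain ⟨T, hTE, hT⟩ := exists_minimal_le_of_wellFoundedLT (IsDraconian P a) E hE
  have hTPN : T ⊆ P ×ˢ N := hTE.trans hEPN
  have hdeg : ∀ i ∈ P, (T.filter (fun e => e.1 = i)).card = a i + 1 := fun i hi =>
    (card_filter_fst_eq T i).trans (card_outNeighbors_singleton_of_minimal hT hi)
  refine ⟨T, hTE, ?_, hdeg⟩
  rw [SimpleGraph.isTree_iff_connected_and_card]
  refine ⟨hT.1.connected hTPN hP hdisj (fun v => ?_) hsum, ?_⟩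
  · rw [← Finset.mem_union, hPN]
    exact Finset.mem_univ v
  have hcardT : T.card = ∑ i ∈ P, (a i + 1) := by
    rw [Finset.card_eq_sum_card_fiberwise (f := Prod.fst) (t := P)
      (fun e he => (Finset.mem_product.1 (hTPN he)).1)]
    exact Finset.sum_congr rfl hdeg
  have hV : Fintype.card V = P.card + N.card := by
    rw [← Finset.card_univ, ← hPN, Finset.card_union_of_disjoint hdisj]
  have hinj : Set.InjOn (fun e : V × V => s(e.1, e.2)) (T : Set (V × V)) := by
    rintro ⟨x, y⟩ hx ⟨x', y'⟩ hx' h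
    have h1 := Finset.mem_product.1 (hTPN hx)
    have h2 := Finset.mem_product.1 (hTPN hx')
    simp only [Sym2.eq_iff] at h
    rcases h with h | h
    · exact Prod.ext h.1 h.2
    · exact absurd h2.2 (Finset.disjoint_left.1 hdisj (h.1 ▸ h1.1))
  have hedges : (SimpleGraph.fromRel (fun u v => (u, v) ∈ T)).edgeSet =
      (fun e : V × V => s(e.1, e.2)) '' (T : Set (V × V)) := by
    ext e
    induction e using Sym2.ind with
    | _ u v =>
      rw [SimpleGraph.mem_edgeSet, SimpleGraph.fromRel_adj]
      constructor
      · rintro ⟨-, h | h⟩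
        · exact ⟨(u, v), h, rfl⟩
        · exact ⟨(v, u), h, Sym2.eq_swap⟩
      · rintro ⟨⟨x, y⟩, h, he⟩
        have h1 := Finset.mem_product.1 (hTPN h)
        have hxy : x ≠ y := fun hxy =>
          Finset.disjoint_left.1 hdisj h1.1 (by simpa [hxy] using h1.2)
        simp only [Sym2.eq_iff] at he
        rcases he with ⟨rfl, rfl⟩ | ⟨rfl, rfl⟩
        · exact ⟨hxy, .inl h⟩
        · exact ⟨hxy.symm, .inr h⟩
  rw [hedges, Nat.card_coe_set_eq, hinj.ncard_image, Set.ncard_coe_finset, hcardT,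
    Nat.card_eq_fintype_card, hV, Finset.sum_add_distrib, Finset.sum_const]
  simp only [smul_eq_mul, mul_one]
  omega

end Combinatorics

section Potential

variable {V : Type*} [DecidableEq V] [Fintype V]

/-- A dual transportation problem with balanced positive weights attains its maximum. -/
theorem exists_maximal_potential {P N : Finset V} (w : V → V → ℝ) (γ : V → ℝ)
    (hγ : ∀ v, 0 < γ v) (hP : P.Nonempty) (hdisj : Disjoint P N) (hPN : P ∪ N = Finset.univ)
    (hbal : ∑ i ∈ P, γ i = ∑ j ∈ N, γ j) :
    ∃ x : V → ℝ, (∀ i ∈ P, ∀ j ∈ N, x j ≤ w i j + x i) ∧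
      ∀ z : V → ℝ, (∀ i ∈ P, ∀ j ∈ N, z j ≤ w i j + z i) →
        ∑ j ∈ N, γ j * z j - ∑ i ∈ P, γ i * z i ≤
          ∑ j ∈ N, γ j * x j - ∑ i ∈ P, γ i * x i := by
  set Φ : (V → ℝ) → ℝ := fun x => ∑ j ∈ N, γ j * x j - ∑ i ∈ P, γ i * x i with hΦ
  have hΦc : Continuous Φ := by fun_prop
  obtain ⟨W, hW⟩ : ∃ W, ∀ i j, |w i j| ≤ W := by
    refine ⟨∑ i, ∑ j, |w i j|, fun i j => ?_⟩
    exact (Finset.single_le_sum (f := fun j => |w i j|) (fun _ _ => abs_nonneg _)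
      (Finset.mem_univ j)).trans (Finset.single_le_sum (f := fun i => ∑ j, |w i j|)
      (fun _ _ => Finset.sum_nonneg fun _ _ => abs_nonneg _) (Finset.mem_univ i))
  obtain ⟨i₀, hi₀⟩ := hP
  have hW0 : 0 ≤ W := (abs_nonneg _).trans (hW i₀ i₀)
  set x₀ : V → ℝ := fun v => if v ∈ N then -W else 0 with hx₀
  have hnotN : ∀ i ∈ P, i ∉ N := fun i hi => Finset.disjoint_left.1 hdisj hi
  set K : Set (V → ℝ) := {x | (∀ i ∈ P, ∀ j ∈ N, x j ≤ w i j + x i) ∧ (∀ i ∈ P, 0 ≤ x i) ∧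
    (∀ j ∈ N, x j ≤ W) ∧ Φ x₀ ≤ Φ x} with hK
  have hx₀K : x₀ ∈ K := by
    refine ⟨fun i hi j hj => ?_, fun i hi => ?_, fun j hj => ?_, le_rfl⟩
    · simp only [hx₀, hj, hnotN i hi, if_true, if_false, add_zero]
      exact (abs_le.1 (hW i j)).1
    · simp [hx₀, hnotN i hi]
    · simp only [hx₀, hj, if_true]
      linarith
  have hclosed : IsClosed K := by
    have hK' : K = (⋂ i ∈ P, ⋂ j ∈ N, {x : V → ℝ | x j ≤ w i j + x i}) ∩
        ((⋂ i ∈ P, {x : V → ℝ | 0 ≤ x i}) ∩ ((⋂ j ∈ N, {x : V → ℝ | x j ≤ W}) ∩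
          {x | Φ x₀ ≤ Φ x})) := by
      ext x
      simp [hK]
    rw [hK']
    refine IsClosed.inter ?_ (IsClosed.inter ?_ (IsClosed.inter ?_ ?_))
    · exact isClosed_biInter fun i _ => isClosed_biInter fun j _ =>
        isClosed_le (by fun_prop) (by fun_prop)
    · exact isClosed_biInter fun i _ => isClosed_le (by fun_prop) (by fun_prop)
    · exact isClosed_biInter fun i _ => isClosed_le (by fun_prop) (by fun_prop)
    · exact isClosed_le continuous_const hΦc
  set S := ∑ j ∈ N, γ j * W with hS
  set D := S - Φ x₀ with hD
  have hgap : ∀ x ∈ K, ∑ j ∈ N, γ j * (W - x j) + ∑ i ∈ P, γ i * x i ≤ D := by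
    rintro x ⟨-, -, -, hx⟩
    simp only [mul_sub, Finset.sum_sub_distrib]
    have : Φ x = ∑ j ∈ N, γ j * x j - ∑ i ∈ P, γ i * x i := rfl
    linarith
  have hbox : K ⊆ Set.Icc (fun v => -(D / γ v)) (fun v => W + D / γ v) := by
    intro x hx
    have hg := hgap x hx
    obtain ⟨-, hxP, hxN, -⟩ := hx
    have nN : ∀ j ∈ N, 0 ≤ γ j * (W - x j) := fun j hj =>
      mul_nonneg (hγ j).le (sub_nonneg.2 (hxN j hj))
    have nP : ∀ i ∈ P, 0 ≤ γ i * x i := fun i hi => mul_nonneg (hγ i).le (hxP i hi)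
    have sN := Finset.sum_nonneg nN
    have sP := Finset.sum_nonneg nP
    have hbd : ∀ v, -(D / γ v) ≤ x v ∧ x v ≤ W + D / γ v := by
      intro v
      have hD0 : 0 ≤ D / γ v := div_nonneg (by linarith) (hγ v).le
      have hv : v ∈ P ∪ N := hPN ▸ Finset.mem_univ v
      rcases Finset.mem_union.1 hv with hv | hv
      · have h1 := Finset.single_le_sum nP hv
        have h2 : x v ≤ D / γ v := by
          rw [le_div_iff₀ (hγ v)]
          linarith
        have h3 := hxP v hv
        constructor <;> linarith
      · have h1 := Finset.single_le_sum nN hv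
        have h2 : W - x v ≤ D / γ v := by
          rw [le_div_iff₀ (hγ v)]
          linarith
        have h3 := hxN v hv
        constructor <;> linarith
    exact ⟨fun v => (hbd v).1, fun v => (hbd v).2⟩
  have hcomp : IsCompact K := isCompact_Icc.of_isClosed_subset hclosed hbox
  obtain ⟨x, hxK, hmax⟩ := hcomp.exists_isMaxOn ⟨x₀, hx₀K⟩ hΦc.continuousOn
  refine ⟨x, hxK.1, fun z hz => ?_⟩
  change Φ z ≤ Φ x
  rcases le_total (Φ z) (Φ x₀) with hle | hge
  · exact hle.trans hxK.2.2.2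
  obtain ⟨m, hm, hmin⟩ := P.exists_min_image z ⟨i₀, hi₀⟩
  set z' : V → ℝ := fun v => z v - z m with hz'
  have hΦz : Φ z' = Φ z := by
    simp only [hΦ, hz', mul_sub, Finset.sum_sub_distrib, ← Finset.sum_mul, hbal]
    ring
  rw [← hΦz]
  refine hmax (show z' ∈ K from ⟨fun i hi j hj => ?_, fun i hi => ?_, fun j hj => ?_, ?_⟩)
  · have := hz i hi j hj
    simp only [hz']
    linarith
  · exact sub_nonneg.2 (hmin i hi)
  · have h1 := hz m hm j hj
    have h2 := (abs_le.1 (hW m j)).2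
    simp only [hz']
    linarith
  · rw [hΦz]
    exact hge

/-- There is a feasible potential whose tight arcs form a Draconian arc set. -/
theorem exists_draconian_potential {P N : Finset V} (w : V → V → ℝ) (a : V → ℕ)
    (hP : P.Nonempty) (hdisj : Disjoint P N) (hPN : P ∪ N = Finset.univ)
    (hsum : ∑ i ∈ P, a i + 1 = N.card) :
    ∃ x : V → ℝ, (∀ i ∈ P, ∀ j ∈ N, x j ≤ w i j + x i) ∧
      IsDraconian P a ((P ×ˢ N).filter (fun e => x e.2 = w e.1 e.2 + x e.1)) := by
  have hp : 0 < P.card := hP.card_pos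
  have hnotP : ∀ j ∈ N, j ∉ P := fun j hj => Finset.disjoint_right.1 hdisj hj
  set γ : V → ℕ := fun v => if v ∈ P then P.card * a v + 1 else P.card with hγ
  have hγP : ∀ A ⊆ P, ∑ i ∈ A, γ i = P.card * ∑ i ∈ A, a i + A.card := by
    intro A hA
    rw [Finset.sum_congr rfl (fun i hi => if_pos (hA hi)), Finset.sum_add_distrib,
      ← Finset.mul_sum, ← Finset.card_eq_sum_ones]
  have hγN : ∀ B ⊆ N, ∑ j ∈ B, γ j = P.card * B.card := by
    intro B hB
    rw [Finset.sum_congr rfl (fun j hj => if_neg (hnotP j (hB hj))), Finset.sum_const,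
      smul_eq_mul, mul_comm]
  have hbal : ∑ i ∈ P, γ i = ∑ j ∈ N, γ j := by
    rw [hγP P subset_rfl, hγN N subset_rfl, ← hsum]
    ring
  obtain ⟨x, hx, hmax⟩ := exists_maximal_potential w (fun v => (γ v : ℝ))
    (fun v => by
      simp only [hγ]
      split_ifs <;> positivity) hP hdisj hPN (by exact_mod_cast hbal)
  refine ⟨x, hx, fun A hA hne => ?_⟩
  set E := (P ×ˢ N).filter (fun e => x e.2 = w e.1 e.2 + x e.1) with hE
  have hout : outNeighbors E A ⊆ N := by
    intro j hj
    obtain ⟨i, -, hij⟩ := mem_outNeighbors.1 hj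
    exact (Finset.mem_product.1 (Finset.mem_filter.1 hij).1).2
  have hslack : ∀ᶠ ε : ℝ in nhdsWithin 0 (Set.Ioi 0),
      ∀ i j, x j < w i j + x i → x j + ε ≤ w i j + x i := by
    rw [Filter.eventually_all]
    intro i
    rw [Filter.eventually_all]
    intro j
    by_cases h : x j < w i j + x i
    · filter_upwards [Ioc_mem_nhdsGT (sub_pos.2 h)] with ε hε _
      linarith [hε.2]
    · exact Filter.Eventually.of_forall fun _ h' => absurd h' h
  obtain ⟨ε, hslackε, hε⟩ := (hslack.and self_mem_nhdsWithin).exists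
  replace hε : 0 < ε := hε
  set A' := P \ A with hA'
  set B := N \ outNeighbors E A with hB
  set z : V → ℝ := fun v => if v ∈ A' ∪ B then x v + ε else x v with hz
  have hzP : ∀ i ∈ P, z i = x i + if i ∈ A' then ε else 0 := by
    intro i hi
    have : i ∉ B := fun h => hnotP i (Finset.mem_sdiff.1 h).1 hi
    by_cases h : i ∈ A' <;> simp [hz, this, h]
  have hzN : ∀ j ∈ N, z j = x j + if j ∈ B then ε else 0 := by
    intro j hj
    have : j ∉ A' := fun h => hnotP j hj (Finset.mem_sdiff.1 h).1
    by_cases h : j ∈ B <;> simp [hz, this, h]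
  have hzfeas : ∀ i ∈ P, ∀ j ∈ N, z j ≤ w i j + z i := by
    intro i hi j hj
    have hxij := hx i hi j hj
    rw [hzP i hi, hzN j hj]
    by_cases hiA : i ∈ A'
    · rw [if_pos hiA]
      split_ifs <;> linarith
    · rw [if_neg hiA]
      split_ifs with hjB
      · have hiA2 : i ∈ A := by
          by_contra h
          exact hiA (Finset.mem_sdiff.2 ⟨hi, h⟩)
        have hlt : x j < w i j + x i := lt_of_le_of_ne hxij fun heq =>
          (Finset.mem_sdiff.1 hjB).2 (mem_outNeighbors.2
            ⟨i, hiA2, Finset.mem_filter.2 ⟨Finset.mk_mem_product hi hj, heq⟩⟩)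
        have := hslackε i j hlt
        linarith
      · linarith
  have key := hmax z hzfeas
  have hsumz : ∀ Q R : Finset V, R ⊆ Q → (∀ v ∈ Q, z v = x v + if v ∈ R then ε else 0) →
      ∑ v ∈ Q, (γ v : ℝ) * z v = ∑ v ∈ Q, (γ v : ℝ) * x v + (∑ v ∈ R, (γ v : ℝ)) * ε := by
    intro Q R hRQ hv
    rw [Finset.sum_congr rfl (fun v h => by rw [hv v h, mul_add, mul_ite, mul_zero]),
      Finset.sum_add_distrib, Finset.sum_ite_mem, Finset.inter_eq_right.2 hRQ, Finset.sum_mul]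
  rw [hsumz N B Finset.sdiff_subset hzN, hsumz P A' Finset.sdiff_subset hzP] at key
  have hle : (∑ v ∈ B, (γ v : ℝ)) ≤ ∑ v ∈ A', (γ v : ℝ) :=
    le_of_mul_le_mul_right (by linarith) hε
  have hleN : ∑ v ∈ B, γ v ≤ ∑ v ∈ A', γ v := by exact_mod_cast hle
  rw [hγN B Finset.sdiff_subset, hγP A' Finset.sdiff_subset] at hleN
  have hcA : A'.card < P.card :=
    Finset.card_lt_card (Finset.sdiff_ssubset hA hne)
  have hBle : B.card < ∑ i ∈ A', a i + 1 := by
    refine lt_of_mul_lt_mul_left (a := P.card) ?_ (Nat.zero_le _)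
    rw [mul_add, mul_one]
    omega
  have hBc : B.card = N.card - (outNeighbors E A).card := Finset.card_sdiff_of_subset hout
  have hsplit : ∑ i ∈ A', a i + ∑ i ∈ A, a i = ∑ i ∈ P, a i := Finset.sum_sdiff hA
  have := Finset.card_le_card hout
  omega

/-- A feasible potential together with a spanning tree of tight arcs with prescribed degrees. -/
theorem exists_potential_isTree {P N : Finset V} (w : V → V → ℝ) (c : V → ℕ)
    (hP : P.Nonempty) (hdisj : Disjoint P N) (hPN : P ∪ N = Finset.univ)
    (hc : ∀ i ∈ P, 1 ≤ c i) (hsum : ∑ i ∈ P, c i + 1 = Fintype.card V) :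
    ∃ (x : V → ℝ) (T : Finset (V × V)), T ⊆ P ×ˢ N ∧
      (∀ i ∈ P, ∀ j ∈ N, x j ≤ w i j + x i) ∧
      (∀ e ∈ T, x e.2 = w e.1 e.2 + x e.1) ∧
      (SimpleGraph.fromRel (fun u v => (u, v) ∈ T)).IsTree ∧
      ∀ i ∈ P, (T.filter (fun e => e.1 = i)).card = c i := by
  have hV : Fintype.card V = P.card + N.card := by
    rw [← Finset.card_univ, ← hPN, Finset.card_union_of_disjoint hdisj]
  have hsplit : ∑ i ∈ P, c i = ∑ i ∈ P, (c i - 1) + P.card := by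
    rw [Finset.card_eq_sum_ones, ← Finset.sum_add_distrib]
    exact Finset.sum_congr rfl fun i hi => (Nat.sub_add_cancel (hc i hi)).symm
  have hsum' : ∑ i ∈ P, (c i - 1) + 1 = N.card := by omega
  obtain ⟨x, hx, hD⟩ := exists_draconian_potential w (fun i => c i - 1) hP hdisj hPN hsum'
  obtain ⟨T, hTE, hT, hdeg⟩ := hD.exists_isTree (Finset.filter_subset _ _) hP hdisj hPN hsum'
  refine ⟨x, T, hTE.trans (Finset.filter_subset _ _), hx,
    fun e he => (Finset.mem_filter.1 (hTE he)).2, hT, fun i hi => ?_⟩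
  rw [hdeg i hi, Nat.sub_add_cancel (hc i hi)]

end Potential

/-- Exponentiating a potential with a tight spanning tree gives a feasible tree solution. -/
theorem isTree_exp_potential {d : ℕ} {π : Fin d → Fin d → ℝ} (h2 : ∀ i j, 0 < π i j)
    {P N : Finset (Fin d)} {x : Fin d → ℝ} {T : Finset (Fin d × Fin d)} (hT : T ⊆ P ×ˢ N)
    (hx : ∀ i ∈ P, ∀ j ∈ N, x j ≤ Real.log (π i j) + x i)
    (htight : ∀ e ∈ T, x e.2 = Real.log (π e.1 e.2) + x e.1)
    (htree : (SimpleGraph.fromRel (fun u v => (u, v) ∈ T)).IsTree) :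
    IsSpanningTree d P N T ∧ GeneratedByTree d π T (fun v => Real.exp (x v)) ∧
      Feasible d π P N (fun v => Real.exp (x v)) := by
  have hexp : ∀ i j, Real.exp (Real.log (π i j) + x i) = π i j * Real.exp (x i) :=
    fun i j => by rw [Real.exp_add, Real.exp_log (h2 i j)]
  refine ⟨⟨fun e he => Finset.mem_product.1 (hT he), htree⟩, fun e he => ⟨?_, Real.exp_pos _⟩,
    fun i hi j hj => ⟨?_, Real.exp_pos _⟩⟩
  · simp only [htight e he, hexp]
  · simpa only [← hexp] using Real.exp_le_exp.2 (hx i hi j hj)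

theorem treeDeg_eq_card_filter {d : ℕ} {T : Finset (Fin d × Fin d)} {i : Fin d}
    {p : Fin d × Fin d → Prop} [DecidablePred p]
    (h : ∀ e ∈ T, (e.1 = i ∨ e.2 = i) ↔ p e) :
    treeDeg d T i = (T.filter p).card := by
  rw [treeDeg, ← Set.ncard_coe_finset]
  congr 1
  ext e
  simp only [Set.mem_ofPred_eq, Finset.mem_coe, Finset.coe_filter]
  exact and_congr_right (h e)

/-- Theorem 7: for every bipartition `(P,N)` of `V` and every `P`-configuration
`c` (a vector of positive integers on `P` summing to `d - 1`) there exists a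
feasible tree solution `y` generated by a spanning tree `T` of `G(P,N)` with
`deg_T(P) = c`; analogously for every `N`-configuration. -/
theorem exists_feasibleTreeSolution_with_configuration (d : ℕ) (hd : 2 ≤ d)
    (π : Fin d → Fin d → ℝ)
    (h1 : ∀ i, π i i = 1)
    (h2 : ∀ i j, 0 < π i j)
    (h3 : ∀ i j k, π i j ≤ π i k * π k j)
    (h4 : ∃ i j k, π i j < π i k * π k j)
    (P N : Finset (Fin d)) (hPN : IsBipartition d P N) :
    (∀ c : Fin d → ℕ, (∀ i ∈ P, 1 ≤ c i) → ∑ i ∈ P, c i = d - 1 →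
      ∃ (y : Fin d → ℝ) (T : Set (Fin d × Fin d)), IsSpanningTree d P N T ∧
        GeneratedByTree d π T y ∧ Feasible d π P N y ∧
        ∀ i ∈ P, treeDeg d T i = c i) ∧
    (∀ b : Fin d → ℕ, (∀ j ∈ N, 1 ≤ b j) → ∑ j ∈ N, b j = d - 1 →
      ∃ (y : Fin d → ℝ) (T : Set (Fin d × Fin d)), IsSpanningTree d P N T ∧
        GeneratedByTree d π T y ∧ Feasible d π P N y ∧
        ∀ j ∈ N, treeDeg d T j = b j) := by
  obtain ⟨hP, hN, hdisj, hcov⟩ := hPN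
  have hcard : d - 1 + 1 = Fintype.card (Fin d) := by
    rw [Fintype.card_fin]
    omega
  refine ⟨fun c hc hsum => ?_, fun b hb hsum => ?_⟩
  · obtain ⟨x, T, hTPN, hx, htight, htree, hdeg⟩ := exists_potential_isTree
      (fun i j => Real.log (π i j)) c hP hdisj hcov hc (by rw [hsum, hcard])
    obtain ⟨hS, hG, hF⟩ := isTree_exp_potential h2 hTPN hx htight htree
    refine ⟨_, T, hS, hG, hF, fun i hi => ?_⟩
    rw [← hdeg i hi]
    refine treeDeg_eq_card_filter fun e he => or_iff_left fun h => ?_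
    exact Finset.disjoint_left.1 hdisj hi (h ▸ (Finset.mem_product.1 (hTPN he)).2)
  · obtain ⟨x, T, hTNP, hx, htight, htree, hdeg⟩ := exists_potential_isTree
      (fun j i => Real.log (π i j)) b hN hdisj.symm (Finset.union_comm N P ▸ hcov) hb
      (by rw [hsum, hcard])
    set T' := T.map (Equiv.prodComm (Fin d) (Fin d)).toEmbedding with hT'
    have hmem : ∀ u v, (u, v) ∈ T' ↔ (v, u) ∈ T := by
      intro u v
      simp [hT']
    have hTPN : T' ⊆ P ×ˢ N := by
      rintro ⟨u, v⟩ h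
      exact Finset.mem_product.2 (Finset.mem_product.1 (hTNP ((hmem u v).1 h))).symm
    have htree' : (SimpleGraph.fromRel (fun u v => (u, v) ∈ T')).IsTree := by
      convert htree using 1
      ext u v
      simp only [SimpleGraph.fromRel_adj, hmem, or_comm]
    obtain ⟨hS, hG, hF⟩ := isTree_exp_potential (x := fun v => -x v) h2 hTPN
      (fun i hi j hj => by linarith [hx j hj i hi])
      (fun e he => by linarith [htight (e.2, e.1) ((hmem e.1 e.2).1 he)]) htree'
    refine ⟨_, T', hS, hG, hF, fun j hj => ?_⟩
    rw [← hdeg j hj, treeDeg_eq_card_filter (p := fun e => e.2 = j)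
      fun e he => or_iff_right fun h =>
        Finset.disjoint_left.1 hdisj (h ▸ (Finset.mem_product.1 (hTPN he)).1) hj,
      hT', Finset.filter_map, Finset.card_map]
    rfl
end
end

section
/- Assume additionally the strict triangle condition π_{ij} < π_{ik} π_{kj} for all i,j ∈ V and all k ∈ V \ {i,j}. If x and y are feasible tree solutions with respect to bipartitions (P_x,N_x) and (P_y,N_y) of V respectively, and (P_x,N_x) ≠ (P_y,N_y), then x ≠ αy for all α > 0. Consequently, the dual cone K_d^+ has at least 2^d − 2 extreme directions (counted up to positive scaling). -/
noncomputable section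

section

variable {d : ℕ} {π : Fin d → Fin d → ℝ}

/-- The arc inequalities `y j ≤ π i j * y i` which describe the dual of the solvency cone. -/
def ArcFeasible (π : Fin d → Fin d → ℝ) (y : Fin d → ℝ) : Prop :=
  ∀ i j, y j ≤ π i j * y i

theorem mem_dualCone_solvencyCone_iff {y : Fin d → ℝ} :
    y ∈ dualCone d (solvencyCone d π) ↔ ArcFeasible π y := by
  constructor
  · intro h i j
    have h0 := h (π i j • (Pi.single i 1 : Fin d → ℝ) - (Pi.single j 1 : Fin d → ℝ))
      ⟨fun a b => if a = i then (if b = j then 1 else 0) else 0, fun a b => by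
        dsimp only; split_ifs <;> norm_num, by
        simp [ite_smul, Finset.sum_ite_eq', Finset.sum_ite_irrel]⟩
    simp [sub_mul, Finset.sum_sub_distrib, Pi.single_apply] at h0
    linarith
  · rintro h x ⟨z, hz, rfl⟩
    have key : ∑ l, (∑ i, ∑ j, z i j • (π i j • (Pi.single i 1 : Fin d → ℝ)
        - (Pi.single j 1 : Fin d → ℝ))) l * y l = ∑ i, ∑ j, z i j * (π i j * y i - y j) := by
      simp only [Finset.sum_apply, Finset.sum_mul]
      rw [Finset.sum_comm]
      refine Finset.sum_congr rfl fun i _ => ?_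
      rw [Finset.sum_comm]
      refine Finset.sum_congr rfl fun j _ => ?_
      simp [Pi.single_apply, mul_sub, sub_mul, Finset.sum_sub_distrib, mul_assoc]
    rw [key]
    exact Finset.sum_nonneg fun i _ => Finset.sum_nonneg fun j _ =>
      mul_nonneg (hz i j) (sub_nonneg.2 (h i j))

theorem ArcFeasible.smul {y : Fin d → ℝ} (h : ArcFeasible π y) {c : ℝ} (hc : 0 ≤ c) :
    ArcFeasible π (c • y) := fun i j => by
  have := mul_le_mul_of_nonneg_left (h i j) hc
  simp only [Pi.smul_apply, smul_eq_mul]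
  linarith

theorem ArcFeasible.add {y z : Fin d → ℝ} (hy : ArcFeasible π y) (hz : ArcFeasible π z) :
    ArcFeasible π (y + z) := fun i j => by
  have := hy i j
  have := hz i j
  simp only [Pi.add_apply]
  linarith

theorem ArcFeasible.nonneg [Nontrivial (Fin d)] (h1 : ∀ i, π i i = 1) (h2 : ∀ i j, 0 < π i j)
    (h5 : ∀ i j k, k ≠ i → k ≠ j → π i j < π i k * π k j) {y : Fin d → ℝ}
    (h : ArcFeasible π y) (i : Fin d) : 0 ≤ y i := by
  obtain ⟨k, hk⟩ := exists_ne i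
  have h3 := h5 i i k hk hk
  rw [h1] at h3
  have h6 := mul_le_mul_of_nonneg_left (h i k) (h2 k i).le
  have h7 := h k i
  nlinarith

theorem ArcFeasible.pos [Nontrivial (Fin d)] (h1 : ∀ i, π i i = 1) (h2 : ∀ i j, 0 < π i j)
    (h5 : ∀ i j k, k ≠ i → k ≠ j → π i j < π i k * π k j) {y : Fin d → ℝ}
    (h : ArcFeasible π y) (hy : y ≠ 0) (i : Fin d) : 0 < y i := by
  obtain ⟨k, hk⟩ := Function.ne_iff.1 hy
  have hk' : 0 < y k := lt_of_le_of_ne (h.nonneg h1 h2 h5 k) (Ne.symm hk)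
  exact pos_of_mul_pos_right (hk'.trans_le (h i k)) (h2 i k).le

/-- A positive vector satisfying all arc inequalities, with a tight outgoing arc at every node
of `P` and a tight incoming arc at every other node. -/
def IsTightOn (π : Fin d → Fin d → ℝ) (P : Finset (Fin d)) (y : Fin d → ℝ) : Prop :=
  ArcFeasible π y ∧ (∀ i, 0 < y i) ∧ (∀ i ∈ P, ∃ k, k ≠ i ∧ π i k * y i = y k) ∧
    ∀ j ∉ P, ∃ l, l ≠ j ∧ π l j * y l = y j

theorem IsTightOn.smul {P : Finset (Fin d)} {y : Fin d → ℝ} (h : IsTightOn π P y) {c : ℝ}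
    (hc : 0 < c) : IsTightOn π P (c • y) := by
  refine ⟨h.1.smul hc.le, fun i => mul_pos hc (h.2.1 i), fun i hi => ?_, fun j hj => ?_⟩
  · obtain ⟨k, hk, e⟩ := h.2.2.1 i hi
    exact ⟨k, hk, by simp only [Pi.smul_apply, smul_eq_mul, ← e]; ring⟩
  · obtain ⟨k, hk, e⟩ := h.2.2.2 j hj
    exact ⟨k, hk, by simp only [Pi.smul_apply, smul_eq_mul, ← e]; ring⟩

theorem IsTightOn.subset
    (h5 : ∀ i j k, k ≠ i → k ≠ j → π i j < π i k * π k j) {P Q : Finset (Fin d)}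
    {y : Fin d → ℝ} (hP : IsTightOn π P y) (hQ : IsTightOn π Q y) : P ⊆ Q := by
  intro i hi
  by_contra hiQ
  obtain ⟨k, hk, e⟩ := hP.2.2.1 i hi
  obtain ⟨l, hl, e'⟩ := hQ.2.2.2 i hiQ
  have h3 := mul_lt_mul_of_pos_right (h5 l k i hl.symm hk.symm) (hP.2.1 l)
  have h4 := hP.1 l k
  rw [← e, ← e'] at h4
  linarith

theorem IsTightOn.unique
    (h5 : ∀ i j k, k ≠ i → k ≠ j → π i j < π i k * π k j) {P Q : Finset (Fin d)}
    {y : Fin d → ℝ} (hP : IsTightOn π P y) (hQ : IsTightOn π Q y) : P = Q :=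
  (hP.subset h5 hQ).antisymm (hQ.subset h5 hP)

theorem IsBipartition.eq_compl {P N : Finset (Fin d)} (h : IsBipartition d P N) : N = Pᶜ :=
  ((isCompl_iff.2 ⟨h.2.2.1, codisjoint_iff.2 h.2.2.2⟩).compl_eq).symm

theorem IsFeasibleTreeSolution.isTightOn [Nontrivial (Fin d)] (h1 : ∀ i, π i i = 1)
    (h2 : ∀ i j, 0 < π i j) (h3 : ∀ i j k, π i j ≤ π i k * π k j) {P N : Finset (Fin d)}
    (hPN : IsBipartition d P N) {y : Fin d → ℝ} (hy : IsFeasibleTreeSolution d π P N y) :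
    IsTightOn π P y := by
  obtain ⟨T, ⟨hTE, hT⟩, hgen, hfeas⟩ := hy
  have hN := hPN.eq_compl
  subst hN
  have hpos : ∀ i, 0 < y i := by
    intro i
    obtain ⟨p, hp⟩ := hPN.1
    obtain ⟨n, hn⟩ := hPN.2.1
    by_cases hi : i ∈ P
    · obtain ⟨h, h'⟩ := hfeas i hi n hn
      exact pos_of_mul_pos_right (h'.trans_le h) (h2 i n).le
    · exact (hfeas p hp i (Finset.mem_compl.2 hi)).2
  have hout : ∀ i ∈ P, ∃ k ∉ P, π i k * y i = y k := by
    intro i hi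
    obtain ⟨k, hk⟩ := hT.1.preconnected.exists_adj_of_nontrivial i
    obtain ⟨-, hk | hk⟩ := (SimpleGraph.fromRel_adj _ _ _).1 hk
    · exact ⟨k, Finset.mem_compl.1 (hTE hk).2, (hgen _ hk).1⟩
    · exact absurd hi (Finset.mem_compl.1 (hTE hk).2)
  have hin : ∀ j ∉ P, ∃ l ∈ P, π l j * y l = y j := by
    intro j hj
    obtain ⟨k, hk⟩ := hT.1.preconnected.exists_adj_of_nontrivial j
    obtain ⟨-, hk | hk⟩ := (SimpleGraph.fromRel_adj _ _ _).1 hk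
    · exact absurd (hTE hk).1 hj
    · exact ⟨k, (hTE hk).1, (hgen _ hk).1⟩
  refine ⟨fun i j => ?_, hpos, fun i hi => ?_, fun j hj => ?_⟩
  · obtain ⟨l, hl, e⟩ : ∃ l ∈ P, π l i * y l = y i := by
      by_cases hi : i ∈ P
      · exact ⟨i, hi, by rw [h1, one_mul]⟩
      · exact hin i hi
    obtain ⟨k, hk, e'⟩ : ∃ k ∉ P, π j k * y j = y k := by
      by_cases hj : j ∈ P
      · exact hout j hj
      · exact ⟨j, hj, by rw [h1, one_mul]⟩
    refine le_of_mul_le_mul_left ?_ (h2 j k)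
    calc π j k * y j = y k := e'
      _ ≤ π l k * y l := (hfeas l hl k (Finset.mem_compl.2 hk)).1
      _ ≤ π l i * π i k * y l := mul_le_mul_of_nonneg_right (h3 l k i) (hpos l).le
      _ = π i k * y i := by rw [← e]; ring
      _ ≤ π i j * π j k * y i := mul_le_mul_of_nonneg_right (h3 i k j) (hpos i).le
      _ = π j k * (π i j * y i) := by ring
  · obtain ⟨k, hk, e⟩ := hout i hi
    exact ⟨k, fun h => hk (h ▸ hi), e⟩
  · obtain ⟨k, hk, e⟩ := hin j hj
    exact ⟨k, fun h => hj (h ▸ hk), e⟩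

/-- The slice of the dual cone on which the coordinates in `P` sum to one. -/
def dualSlice (π : Fin d → Fin d → ℝ) (P : Finset (Fin d)) : Set (Fin d → ℝ) :=
  {y | ArcFeasible π y ∧ ∑ i ∈ P, y i = 1}

theorem isCompact_dualSlice (h2 : ∀ i j, 0 < π i j) {P : Finset (Fin d)} (hP : P.Nonempty)
    (hnn : ∀ y, ArcFeasible π y → ∀ i, 0 ≤ y i) : IsCompact (dualSlice π P) := by
  obtain ⟨p, hp⟩ := hP
  refine (isCompact_Icc (a := (0 : Fin d → ℝ)) (b := π p)).of_isClosed_subset ?_ ?_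
  · have h : dualSlice π P =
        (⋂ i, ⋂ j, {y | y j ≤ π i j * y i}) ∩ {y | ∑ i ∈ P, y i = 1} := by
      ext y
      simp [dualSlice, ArcFeasible]
    rw [h]
    exact (isClosed_iInter fun i => isClosed_iInter fun j =>
      isClosed_le (by fun_prop) (by fun_prop)).inter (isClosed_eq (by fun_prop) continuous_const)
  · rintro y ⟨hy, hs⟩
    refine ⟨fun i => hnn y hy i, fun j => (hy p j).trans ?_⟩
    have hp1 : y p ≤ 1 := hs ▸ Finset.single_le_sum (fun i _ => hnn y hy i) hp
    exact mul_le_of_le_one_right (h2 p j).le hp1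

theorem inv_smul_mem_dualSlice {P : Finset (Fin d)} {u : Fin d → ℝ} (hu : ArcFeasible π u)
    (hs : 0 < ∑ i ∈ P, u i) : (∑ i ∈ P, u i)⁻¹ • u ∈ dualSlice π P := by
  refine ⟨hu.smul (inv_nonneg.2 hs.le), ?_⟩
  simp only [Pi.smul_apply, smul_eq_mul, ← Finset.mul_sum]
  exact inv_mul_cancel₀ hs.ne'

theorem isExtremeDir_of_mem_extremePoints {P : Finset (Fin d)} (hP : P.Nonempty)
    (hpos : ∀ y, ArcFeasible π y → y ≠ 0 → ∀ i, 0 < y i) {y : Fin d → ℝ}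
    (hy : y ∈ (dualSlice π P).extremePoints ℝ) :
    IsExtremeDir d (dualCone d (solvencyCone d π)) y := by
  refine ⟨mem_dualCone_solvencyCone_iff.2 hy.1.1, ?_, ?_⟩
  · rintro rfl
    simpa using hy.1.2
  · intro u v hu hv hu0 hv0 huv
    rw [mem_dualCone_solvencyCone_iff] at hu hv
    have hs : 0 < ∑ i ∈ P, u i := Finset.sum_pos (fun i _ => hpos u hu hu0 i) hP
    have ht : 0 < ∑ i ∈ P, v i := Finset.sum_pos (fun i _ => hpos v hv hv0 i) hP
    have hst : ∑ i ∈ P, u i + ∑ i ∈ P, v i = 1 := by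
      rw [← Finset.sum_add_distrib, ← hy.1.2, huv]
      rfl
    have := hy.2 (inv_smul_mem_dualSlice hu hs) (inv_smul_mem_dualSlice hv ht)
      ⟨_, _, hs, ht, hst, by rw [smul_inv_smul₀ hs.ne', smul_inv_smul₀ ht.ne', huv]⟩
    exact Or.inl ⟨_, hs, by rw [← this, smul_inv_smul₀ hs.ne']⟩

theorem ArcFeasible.update {y : Fin d → ℝ} (hy : ArcFeasible π y) (h1 : ∀ i, π i i = 1)
    {i : Fin d} {t : ℝ} (hout : ∀ k, k ≠ i → y k ≤ π i k * t)
    (hin : ∀ k, k ≠ i → t ≤ π k i * y k) : ArcFeasible π (Function.update y i t) := by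
  intro a b
  by_cases ha : a = i <;> by_cases hb : b = i
  · subst ha; subst hb; simp [h1]
  · subst ha; simpa [hb] using hout b hb
  · subst hb; simpa [ha] using hin a ha
  · simpa [ha, hb] using hy a b

theorem exists_isTightOn_isExtremeDir [Nontrivial (Fin d)] (h1 : ∀ i, π i i = 1)
    (h2 : ∀ i j, 0 < π i j) (h3 : ∀ i j k, π i j ≤ π i k * π k j)
    (h5 : ∀ i j k, k ≠ i → k ≠ j → π i j < π i k * π k j) {P : Finset (Fin d)}
    (hP : P.Nonempty) (hPc : Pᶜ.Nonempty) :
    ∃ y, IsTightOn π P y ∧ IsExtremeDir d (dualCone d (solvencyCone d π)) y := by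
  have hnn : ∀ y, ArcFeasible π y → ∀ i, 0 ≤ y i := fun y hy => hy.nonneg h1 h2 h5
  have hpos : ∀ y, ArcFeasible π y → y ≠ 0 → ∀ i, 0 < y i := fun y hy => hy.pos h1 h2 h5
  have hS := isCompact_dualSlice h2 hP hnn
  have hSne : (dualSlice π P).Nonempty :=
    ⟨_, inv_smul_mem_dualSlice (u := π hP.choose) (fun i j => (h3 _ j i).trans_eq (mul_comm _ _))
      (Finset.sum_pos (fun i _ => h2 _ i) hP)⟩
  let f : StrongDual ℝ (Fin d → ℝ) := ∑ j ∈ Pᶜ, ContinuousLinearMap.proj j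
  have hf : ∀ z, f z = ∑ j ∈ Pᶜ, z j := fun z => by simp [f]
  have hexp : IsExposed ℝ (dualSlice π P) (f.toExposed (dualSlice π P)) :=
    ContinuousLinearMap.toExposed.isExposed
  obtain ⟨m, hm, hmax⟩ := hS.exists_isMaxOn hSne f.continuous.continuousOn
  obtain ⟨y, hy⟩ := (hexp.isCompact hS).extremePoints_nonempty ⟨m, hm, fun z hz => hmax hz⟩
  have hyS := hexp.isExtreme.extremePoints_subset_extremePoints hy
  have hyE := isExtremeDir_of_mem_extremePoints hP hpos hyS
  have hyA : ArcFeasible π y := hyS.1.1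
  have hypos := hpos y hyA hyE.2.1
  have hM : 0 < f y := by
    rw [hf]
    exact Finset.sum_pos (fun i _ => hypos i) hPc
  have hopt : ∀ z, ArcFeasible π z → f z ≤ f y * ∑ i ∈ P, z i := by
    intro z hz
    by_cases hz0 : z = 0
    · simp [hz0]
    have hs : 0 < ∑ i ∈ P, z i := Finset.sum_pos (fun i _ => hpos z hz hz0 i) hP
    have := hy.1.2 _ (inv_smul_mem_dualSlice hz hs)
    rw [map_smul, smul_eq_mul, inv_mul_le_iff₀ hs] at this
    linarith
  refine ⟨y, ⟨hyA, hypos, fun i hi => ?_, fun j hj => ?_⟩, hyE⟩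
  · by_contra! hcon
    have hev : ∀ᶠ t in nhdsWithin (y i) (Set.Iio (y i)), ∀ k, k ≠ i → y k < π i k * t := by
      refine Filter.Eventually.filter_mono nhdsWithin_le_nhds ?_
      refine Filter.eventually_all.2 fun k => ?_
      by_cases hk : k = i
      · simp [hk]
      have hc : Filter.Tendsto (fun t => π i k * t) (nhds (y i)) (nhds (π i k * y i)) :=
        (continuous_const.mul continuous_id).tendsto _
      filter_upwards [hc.eventually_const_lt (lt_of_le_of_ne (hyA i k) (hcon k hk).symm)]
        with t ht _ using ht
    obtain ⟨t, ht, hti⟩ := (hev.and self_mem_nhdsWithin).exists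
    have := hopt _ (hyA.update h1 (fun k hk => (ht k hk).le)
      fun k _ => hti.le.trans (hyA k i))
    rw [hf, Finset.sum_update_of_notMem (by simpa using hi), ← hf,
      Finset.sum_update_of_mem hi] at this
    have hsum : ∑ i ∈ P, y i = 1 := hyS.1.2
    rw [Finset.sum_eq_add_sum_sdiff_singleton_of_mem hi] at hsum
    nlinarith
  · by_contra! hcon
    have hev : ∀ᶠ t in nhdsWithin (y j) (Set.Ioi (y j)), ∀ k, k ≠ j → t < π k j * y k := by
      refine Filter.Eventually.filter_mono nhdsWithin_le_nhds ?_
      refine Filter.eventually_all.2 fun k => ?_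
      by_cases hk : k = j
      · simp [hk]
      filter_upwards [eventually_lt_nhds (lt_of_le_of_ne (hyA k j) (hcon k hk).symm)]
        with t ht _ using ht
    obtain ⟨t, ht, htj⟩ := (hev.and self_mem_nhdsWithin).exists
    have := hopt _ (hyA.update h1
      (fun k _ => (hyA j k).trans (mul_le_mul_of_nonneg_left htj.le (h2 j k).le))
      fun k hk => (ht k hk).le)
    have hj' : j ∈ Pᶜ := Finset.mem_compl.2 hj
    rw [hf, Finset.sum_update_of_notMem hj, Finset.sum_update_of_mem hj', hyS.1.2, mul_one, hf,
      Finset.sum_eq_add_sum_sdiff_singleton_of_mem hj'] at this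
    linarith

end

/-- Corollary 9: under the strict triangle condition (5), feasible tree solutions
with respect to different bipartitions are not positive multiples of each other,
and `K_d^+` has at least `2^d - 2` extreme directions (up to positive scaling). -/
theorem feasibleTreeSolutions_distinct_and_atLeast_extremeDirs (d : ℕ) (hd : 2 ≤ d)
    (π : Fin d → Fin d → ℝ)
    (h1 : ∀ i, π i i = 1)
    (h2 : ∀ i j, 0 < π i j)
    (h3 : ∀ i j k, π i j ≤ π i k * π k j)
    (h4 : ∃ i j k, π i j < π i k * π k j)
    (h5 : ∀ i j k, k ≠ i → k ≠ j → π i j < π i k * π k j) :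
    (∀ (x y : Fin d → ℝ) (Px Nx Py Ny : Finset (Fin d)),
      IsBipartition d Px Nx → IsBipartition d Py Ny →
      IsFeasibleTreeSolution d π Px Nx x → IsFeasibleTreeSolution d π Py Ny y →
      (Px, Nx) ≠ (Py, Ny) → ∀ α : ℝ, 0 < α → x ≠ α • y) ∧
    (∃ Y : Finset (Fin d → ℝ), Y.card = 2 ^ d - 2 ∧
      (∀ z ∈ Y, IsExtremeDir d (dualCone d (solvencyCone d π)) z) ∧
      (∀ z ∈ Y, ∀ w ∈ Y, (∃ α : ℝ, 0 < α ∧ z = α • w) → z = w)) := by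
  have : Nontrivial (Fin d) := Fin.nontrivial_iff_two_le.2 hd
  constructor
  · rintro x y Px Nx Py Ny hPx hPy hx hy hne α hα rfl
    have h := (hx.isTightOn h1 h2 h3 hPx).unique h5 ((hy.isTightOn h1 h2 h3 hPy).smul hα)
    exact hne (by rw [hPx.eq_compl, hPy.eq_compl, h])
  · have hex : ∀ P : Finset (Fin d), ∃ y, P ≠ ∅ → P ≠ Finset.univ →
        IsTightOn π P y ∧ IsExtremeDir d (dualCone d (solvencyCone d π)) y := by
      intro P
      by_cases hP : P ≠ ∅ ∧ P ≠ Finset.univ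
      · obtain ⟨y, hy⟩ := exists_isTightOn_isExtremeDir h1 h2 h3 h5
          (Finset.nonempty_iff_ne_empty.2 hP.1)
          (Finset.nonempty_iff_ne_empty.2 fun h => hP.2 (Finset.compl_eq_empty_iff P |>.1 h))
        exact ⟨y, fun _ _ => hy⟩
      · exact ⟨0, fun h h' => absurd ⟨h, h'⟩ hP⟩
    choose y hy using hex
    let I : Finset (Finset (Fin d)) := {∅, Finset.univ}ᶜ
    have hI : ∀ P ∈ I, IsTightOn π P (y P) ∧
        IsExtremeDir d (dualCone d (solvencyCone d π)) (y P) := by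
      intro P hP
      simp only [I, Finset.mem_compl, Finset.mem_insert, Finset.mem_singleton, not_or] at hP
      exact hy P hP.1 hP.2
    classical
    refine ⟨I.image y, ?_, ?_, ?_⟩
    · rw [Finset.card_image_of_injOn, Finset.card_compl, Finset.card_pair, Fintype.card_finset,
        Fintype.card_fin]
      · exact Finset.univ_nonempty.ne_empty.symm
      · intro P hP Q hQ h
        have hQ' := (hI Q hQ).1
        rw [← h] at hQ'
        exact (hI P hP).1.unique h5 hQ'
    · intro z hz
      obtain ⟨P, hP, rfl⟩ := Finset.mem_image.1 hz
      exact (hI P hP).2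
    · rintro z hz w hw ⟨α, hα, h⟩
      obtain ⟨P, hP, rfl⟩ := Finset.mem_image.1 hz
      obtain ⟨Q, hQ, rfl⟩ := Finset.mem_image.1 hw
      have hQ' := (hI Q hQ).1.smul hα
      rw [← h] at hQ'
      rw [(hI P hP).1.unique h5 hQ']
end
end
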